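/- arXiv:1407.0676 — 2 statements merged into one kernel-verified Lean document; each statement's English description precedes it below -/
import Mathlib

section
/- Let q ∈ (0,1/2), let a = (a_i) be a sequence of positive integers, and let (C,D) be the pair of generalised Cantor sets generated by (q,a). Then the upper box-counting dimensions satisfy dim_B C = −(log 2/log q) · limsup_{k→∞} (Σ_{j=1}^k a_{2j−1})/(Σ_{i=1}^{2k−1} a_i) and dim_B D = −(log 2/log q) · limsup_{k→∞} (Σ_{j=1}^k a_{2j})/(Σ_{i=1}^{2k} a_i). -/
open Metric Set Filter
open scoped ENNReal NNReal

namespace Paper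

noncomputable def coverNum {X : Type*} [MetricSpace X] (F : Set X) (r : ℝ) : ℝ≥0∞ :=
  ⨅ (s : Finset X) (_ : F ⊆ ⋃ x ∈ s, closedBall x r), (s.card : ℝ≥0∞)

noncomputable def diamCoverNum {X : Type*} [MetricSpace X] (F : Set X) (r : ℝ) : ℝ≥0∞ :=
  ⨅ (U : Finset (Set X)) (_ : F ⊆ ⋃₀ ↑U)
    (_ : ∀ A ∈ U, EMetric.diam A ≤ ENNReal.ofReal r), (U.card : ℝ≥0∞)

noncomputable def lowerBoxDim {X : Type*} [MetricSpace X] (F : Set X) : ℝ :=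
  Filter.liminf (fun r : ℝ => Real.log (coverNum F r).toReal / (-Real.log r))
    (nhdsWithin 0 (Set.Ioi 0))

noncomputable def upperBoxDim {X : Type*} [MetricSpace X] (F : Set X) : ℝ :=
  Filter.limsup (fun r : ℝ => Real.log (coverNum F r).toReal / (-Real.log r))
    (nhdsWithin 0 (Set.Ioi 0))

def IsHomogeneous {X : Type*} [MetricSpace X] (F : Set X) (s : ℝ) : Prop :=
  ∀ δ₀ : ℝ, 0 < δ₀ → ∃ C : ℝ, 0 < C ∧
    ∀ x ∈ F, ∀ δ ρ : ℝ, 0 < ρ → ρ < δ → δ ≤ δ₀ →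
      coverNum (closedBall x δ ∩ F) ρ ≤ ENNReal.ofReal (C * (δ / ρ) ^ s)

noncomputable def assouadDim {X : Type*} [MetricSpace X] (F : Set X) : EReal :=
  sInf ((fun s : ℝ => (s : EReal)) '' {s : ℝ | 0 ≤ s ∧ IsHomogeneous F s})

def EquiHomogeneous {X : Type*} [MetricSpace X] (F : Set X) : Prop :=
  ∀ δ₀ : ℝ, 0 < δ₀ → ∃ M : ℝ≥0, 1 ≤ M ∧ ∃ c₁ c₂ : ℝ, 0 < c₁ ∧ 0 < c₂ ∧
    ∀ δ ρ : ℝ, 0 < ρ → ρ < δ → δ ≤ δ₀ →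
      (⨆ x ∈ F, coverNum (closedBall x δ ∩ F) ρ) ≤
        (M : ℝ≥0∞) * ⨅ x ∈ F, coverNum (closedBall x (c₁ * δ) ∩ F) (c₂ * ρ)

noncomputable def cantorLen (lam : ℕ → ℝ) (n : ℕ) : ℝ := ∏ i ∈ Finset.range n, lam i

noncomputable def cantorPre (lam : ℕ → ℝ) (n : ℕ) : Set ℝ :=
  ⋃ ε : ℕ → Bool,
    Set.Icc (∑ i ∈ Finset.range n, if ε i then cantorLen lam i - cantorLen lam (i + 1) else 0)
      ((∑ i ∈ Finset.range n, if ε i then cantorLen lam i - cantorLen lam (i + 1) else 0) +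
        cantorLen lam n)

noncomputable def cantorSet (lam : ℕ → ℝ) : Set ℝ := ⋂ n : ℕ, cantorPre lam n

open Classical in
noncomputable def lamSeq (q : ℝ) (a : ℕ → ℕ) (i : ℕ) : ℝ :=
  if h : ∃ k : ℕ, i + 1 = ∑ j ∈ Finset.range (k + 1), a (2 * j) then
    q ^ (a (2 * h.choose + 1) + 1)
  else q

open Classical in
noncomputable def muSeq (q : ℝ) (a : ℕ → ℕ) (i : ℕ) : ℝ :=
  if h : ∃ k : ℕ, i + 1 = a 0 + ∑ j ∈ Finset.range (k + 1), a (2 * j + 1) then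
    q ^ (a (2 * h.choose + 2) + 1)
  else q

noncomputable def prodSetL2 (C D : Set ℝ) : Set (WithLp 2 (ℝ × ℝ)) :=
  (WithLp.equiv 2 (ℝ × ℝ)).symm '' (C ×ˢ D)

theorem limsup_le_limsup_of_forall_pos {α β : Type*} {l : Filter α} {l' : Filter β} [l.NeBot]
    {f : α → ℝ} {g : β → ℝ} (hf : ∀ᶠ x in l, 0 ≤ f x)
    (hg : IsBoundedUnder (· ≤ ·) l' g)
    (h : ∀ ε > 0, ∀ s ∈ l', ∀ᶠ x in l, ∃ y ∈ s, f x ≤ g y + ε) :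
    limsup f l ≤ limsup g l' := by
  refine le_of_forall_pos_le_add fun ε hε => ?_
  have h1 : ∀ᶠ y in l', g y < limsup g l' + ε / 2 :=
    eventually_lt_of_limsup_lt (by linarith) hg
  refine limsup_le_of_le (IsBoundedUnder.isCoboundedUnder_le ⟨0, hf⟩) ?_
  filter_upwards [h (ε / 2) (by linarith) _ h1] with x ⟨y, hy, hxy⟩
  have : g y < limsup g l' + ε / 2 := hy
  linarith

theorem limsup_const_mul_of_mem_Icc {v : ℕ → ℝ} (hv : ∀ k, v k ∈ Icc (0 : ℝ) 1) {s : ℝ}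
    (hs : 0 ≤ s) : limsup (fun k => s * v k) atTop = s * limsup v atTop := by
  have hmono : Monotone fun x : ℝ => s * x := fun x y h => mul_le_mul_of_nonneg_left h hs
  have hbdd : IsBoundedUnder (· ≤ ·) atTop v :=
    ⟨1, eventually_map.2 (.of_forall fun k => (hv k).2)⟩
  have hbdd' : IsBoundedUnder (· ≥ ·) atTop v :=
    ⟨0, eventually_map.2 (.of_forall fun k => (hv k).1)⟩
  exact (hmono.map_limsup_of_continuousAt v (by fun_prop) hbdd hbdd'.isCoboundedUnder_le).symm

section Cantor

variable {lam : ℕ → ℝ} {q : ℝ}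

theorem cantorLen_succ (lam : ℕ → ℝ) (n : ℕ) :
    cantorLen lam (n + 1) = cantorLen lam n * lam n := by
  simp [cantorLen, Finset.prod_range_succ]

theorem cantorLen_pos (h0 : ∀ i, 0 < lam i) (n : ℕ) : 0 < cantorLen lam n :=
  Finset.prod_pos fun i _ => h0 i

theorem cantorLen_antitone (h0 : ∀ i, 0 < lam i) (h1 : ∀ i, lam i ≤ 1) :
    Antitone (cantorLen lam) :=
  antitone_nat_of_succ_le fun n => by
    rw [cantorLen_succ]
    exact mul_le_of_le_one_right (cantorLen_pos h0 n).le (h1 n)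

theorem cantorLen_le_pow (h0 : ∀ i, 0 < lam i) (hq : ∀ i, lam i ≤ q) (n : ℕ) :
    cantorLen lam n ≤ q ^ n := by
  have := Finset.prod_le_prod (s := Finset.range n) (fun i _ => (h0 i).le) (fun i _ => hq i)
  simpa [cantorLen] using this

theorem sum_Ico_ite_cantorLen_le (h0 : ∀ i, 0 < lam i) (h1 : ∀ i, lam i ≤ 1) (P : ℕ → Prop)
    [DecidablePred P] {m n : ℕ} (hmn : m ≤ n) :
    ∑ i ∈ Finset.Ico m n, (if P i then cantorLen lam i - cantorLen lam (i + 1) else 0) ≤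
      cantorLen lam m - cantorLen lam n := by
  have e := Finset.sum_Ico_sub (cantorLen lam) hmn
  rw [← neg_sub (cantorLen lam n), ← e, ← Finset.sum_neg_distrib]
  simp only [neg_sub]
  refine Finset.sum_le_sum fun i _ => ?_
  have := cantorLen_antitone h0 h1 (Nat.le_succ i)
  split_ifs
  · exact le_rfl
  · exact sub_nonneg.2 this

theorem sum_Ico_ite_cantorLen_nonneg (h0 : ∀ i, 0 < lam i) (h1 : ∀ i, lam i ≤ 1) (P : ℕ → Prop)
    [DecidablePred P] (m n : ℕ) :
    0 ≤ ∑ i ∈ Finset.Ico m n, (if P i then cantorLen lam i - cantorLen lam (i + 1) else 0) := by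
  refine Finset.sum_nonneg fun i _ => ?_
  have := cantorLen_antitone h0 h1 (Nat.le_succ i)
  split_ifs
  · exact sub_nonneg.2 this
  · exact le_rfl

theorem coverNum_cantorSet_le {n : ℕ} {r : ℝ} (hr : cantorLen lam n ≤ r) :
    coverNum (cantorSet lam) r ≤ 2 ^ n := by
  classical
  let s : Finset ℝ := (Finset.range n).powerset.image
    fun T => ∑ i ∈ T, (cantorLen lam i - cantorLen lam (i + 1))
  have hs : cantorSet lam ⊆ ⋃ x ∈ s, closedBall x r := by
    intro x hx
    obtain ⟨ε, hε⟩ := mem_iUnion.1 (mem_iInter.1 hx n)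
    refine mem_iUnion₂.2 ⟨_, Finset.mem_image_of_mem _
      (Finset.mem_powerset.2 (Finset.filter_subset (fun i => ε i = true) _)), ?_⟩
    rw [Finset.sum_filter, mem_closedBall, Real.dist_eq, abs_le]
    constructor <;> linarith [hε.1, hε.2]
  refine (iInf₂_le s hs).trans ?_
  have : s.card ≤ 2 ^ n := Finset.card_image_le.trans (by simp)
  exact_mod_cast this

/-- The left endpoints of the construction intervals belong to the Cantor set. -/
theorem sum_mem_cantorSet (h0 : ∀ i, 0 < lam i) (h1 : ∀ i, lam i ≤ 1) (T : Finset ℕ) (n : ℕ) :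
    (∑ i ∈ Finset.range n, if i ∈ T then cantorLen lam i - cantorLen lam (i + 1) else 0) ∈
      cantorSet lam := by
  refine mem_iInter.2 fun m => mem_iUnion.2
    ⟨fun i => decide (i ∈ T ∧ i < n), ?_⟩
  have hlen := cantorLen_pos h0
  have e1 : (∑ i ∈ Finset.range n,
      if i ∈ T then cantorLen lam i - cantorLen lam (i + 1) else 0) =
      ∑ i ∈ Finset.range (max m n),
        if i ∈ T ∧ i < n then cantorLen lam i - cantorLen lam (i + 1) else 0 := by
    rw [← Finset.sum_subset (Finset.range_subset_range.2 (le_max_right m n))]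
    · refine Finset.sum_congr rfl fun i hi => ?_
      simp [Finset.mem_range.1 hi]
    · intro i _ hi
      rw [if_neg]
      simpa using fun _ => by simpa using hi
  rw [e1, ← Finset.sum_range_add_sum_Ico _ (le_max_left m n)]
  have h2 := sum_Ico_ite_cantorLen_le h0 h1 (fun i => i ∈ T ∧ i < n) (le_max_left m n)
  have h3 := sum_Ico_ite_cantorLen_nonneg h0 h1 (fun i => i ∈ T ∧ i < n) m (max m n)
  have h4 := hlen (max m n)
  simp only [decide_eq_true_eq, mem_Icc]
  constructor <;> linarith

theorem lt_sum_sub_sum (h0 : ∀ i, 0 < lam i) (h1 : ∀ i, lam i ≤ 1) {n i : ℕ} {r : ℝ}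
    (hi : i < n) (hr : r < cantorLen lam i - 2 * cantorLen lam (i + 1)) {T S : Finset ℕ}
    (hT : i ∈ T) (hS : i ∉ S) (hlt : ∀ j < i, j ∈ T ↔ j ∈ S) :
    r < (∑ j ∈ Finset.range n, if j ∈ T then cantorLen lam j - cantorLen lam (j + 1) else 0) -
      ∑ j ∈ Finset.range n, if j ∈ S then cantorLen lam j - cantorLen lam (j + 1) else 0 := by
  have hin : i + 1 ≤ n := hi
  rw [← Finset.sum_range_add_sum_Ico _ hin, ← Finset.sum_range_add_sum_Ico _ hin,
    Finset.sum_range_succ, Finset.sum_range_succ, if_pos hT, if_neg hS]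
  have e : (∑ j ∈ Finset.range i,
      if j ∈ T then cantorLen lam j - cantorLen lam (j + 1) else 0) =
      ∑ j ∈ Finset.range i,
        if j ∈ S then cantorLen lam j - cantorLen lam (j + 1) else 0 :=
    Finset.sum_congr rfl fun j hj => by simp only [hlt j (Finset.mem_range.1 hj)]
  have h2 := sum_Ico_ite_cantorLen_le h0 h1 (fun i => i ∈ S) hin
  have h3 := sum_Ico_ite_cantorLen_nonneg h0 h1 (fun i => i ∈ T) (i + 1) n
  have h4 := cantorLen_pos h0 n
  rw [e]
  linarith

theorem le_coverNum_cantorSet (h0 : ∀ i, 0 < lam i) (h1 : ∀ i, lam i ≤ 1) {n : ℕ} {r : ℝ}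
    (hr : ∀ i < n, 2 * r < cantorLen lam i - 2 * cantorLen lam (i + 1)) :
    2 ^ n ≤ coverNum (cantorSet lam) r := by
  classical
  refine le_iInf₂ fun s hs => ?_
  let x : Finset ℕ → ℝ := fun T => ∑ i ∈ Finset.range n,
    if i ∈ T then cantorLen lam i - cantorLen lam (i + 1) else 0
  have hx : ∀ T, ∃ y ∈ s, dist (x T) y ≤ r := fun T => by
    simpa only [mem_iUnion, mem_closedBall, exists_prop] using hs (sum_mem_cantorSet h0 h1 T n)
  choose c hcs hcd using hx
  have hle : ∀ T S, c T = c S → x T - x S ≤ 2 * r := fun T S h => by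
    have e1 := abs_le.1 (Real.dist_eq _ _ ▸ hcd T)
    have e2 := abs_le.1 (Real.dist_eq _ _ ▸ hcd S)
    rw [h] at e1
    linarith [e1.2, e2.1]
  have hinj : Set.InjOn c ((Finset.range n).powerset : Set (Finset ℕ)) := by
    intro T hT S hS hTS
    by_contra hne
    have hex : ∃ i, ¬ (i ∈ T ↔ i ∈ S) := by
      by_contra! h
      exact hne (Finset.ext h)
    have hmin : ∀ j < Nat.find hex, (j ∈ T ↔ j ∈ S) := fun j hj =>
      not_not.1 (Nat.find_min hex hj)
    have hsub : ∀ {U : Finset ℕ}, U ∈ ((Finset.range n).powerset : Set (Finset ℕ)) →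
        ∀ j ∈ U, j < n := fun hU j hj =>
      Finset.mem_range.1 (Finset.mem_powerset.1 (Finset.mem_coe.1 hU) hj)
    by_cases hmem : Nat.find hex ∈ T
    · have hmem' : Nat.find hex ∉ S := fun h => Nat.find_spec hex ⟨fun _ => h, fun _ => hmem⟩
      have hin := hsub hT _ hmem
      exact absurd (lt_sum_sub_sum h0 h1 hin (hr _ hin) hmem hmem' hmin)
        (not_lt.2 (hle T S hTS))
    · have hmem' : Nat.find hex ∈ S := by
        by_contra h
        exact Nat.find_spec hex ⟨fun h' => absurd h' hmem, fun h' => absurd h' h⟩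
      have hin := hsub hS _ hmem'
      exact absurd (lt_sum_sub_sum h0 h1 hin (hr _ hin) hmem' hmem
        fun j hj => (hmin j hj).symm) (not_lt.2 (hle S T hTS.symm))
  have := Finset.card_le_card_of_injOn c (fun T _ => hcs T) hinj
  rw [Finset.card_powerset, Finset.card_range] at this
  exact_mod_cast this

theorem log_coverNum_le (h0 : ∀ i, 0 < lam i) (h1 : ∀ i, lam i ≤ 1) {n : ℕ} {r : ℝ}
    (hr : cantorLen lam n ≤ r) :
    Real.log (coverNum (cantorSet lam) r).toReal ≤ n * Real.log 2 := by
  have hge : 1 ≤ coverNum (cantorSet lam) r := by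
    simpa using le_coverNum_cantorSet (n := 0) (r := r) h0 h1 (by simp)
  have hle := coverNum_cantorSet_le hr
  have htop : (2 ^ n : ℝ≥0∞) ≠ ⊤ := by simp
  have hle' := ENNReal.toReal_mono htop hle
  have hge' := ENNReal.toReal_mono (ne_top_of_le_ne_top htop hle) hge
  simp only [ENNReal.toReal_one, ENNReal.toReal_pow, ENNReal.toReal_ofNat] at hle' hge'
  rw [← Real.log_pow]
  exact Real.log_le_log (by linarith) hle'

theorem le_log_coverNum (h0 : ∀ i, 0 < lam i) (h1 : ∀ i, lam i ≤ 1) {m n : ℕ} {r : ℝ}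
    (hm : cantorLen lam m ≤ r)
    (hr : ∀ i < n, 2 * r < cantorLen lam i - 2 * cantorLen lam (i + 1)) :
    n * Real.log 2 ≤ Real.log (coverNum (cantorSet lam) r).toReal := by
  have htop : (2 ^ m : ℝ≥0∞) ≠ ⊤ := by simp
  have hge' := ENNReal.toReal_mono (ne_top_of_le_ne_top htop (coverNum_cantorSet_le hm))
    (le_coverNum_cantorSet h0 h1 hr)
  simp only [ENNReal.toReal_pow, ENNReal.toReal_ofNat] at hge'
  rw [← Real.log_pow]
  exact Real.log_le_log (by positivity) hge'

theorem cantorLen_eq_pow {p g : ℕ → ℕ} (hp : StrictMono p) (hp0 : 0 < p 0)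
    (hlam : ∀ k i, i + 1 = p k → lam i = q ^ (g k + 1))
    (hlam' : ∀ i, (∀ k, i + 1 ≠ p k) → lam i = q) (n : ℕ) :
    ∀ k, n < p k → (∀ j < k, p j ≤ n) →
      cantorLen lam n = q ^ (n + ∑ j ∈ Finset.range k, g j) := by
  induction n with
  | zero =>
    intro k _ hk
    obtain rfl : k = 0 := by
      by_contra h
      have := hk 0 (Nat.pos_of_ne_zero h)
      omega
    simp [cantorLen]
  | succ n ih =>
    intro k hnk hk
    rw [cantorLen_succ]
    by_cases h : ∃ k', n + 1 = p k'
    · obtain ⟨k', hk'⟩ := h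
      have h1 : k' < k := hp.lt_iff_lt.1 (hk' ▸ hnk)
      obtain rfl : k = k' + 1 := by
        by_contra hne
        have := hk (k' + 1) (by omega)
        have : p k' < p (k' + 1) := hp (Nat.lt_succ_self k')
        omega
      rw [hlam k' n hk', ih k' (by omega) fun j hj => by have := hp hj; omega,
        Finset.sum_range_succ, ← pow_add]
      congr 1
      ring
    · push Not at h
      rw [hlam' n h, ih k (by omega) fun j hj => by have := hk j hj; have := h j; omega,
        ← pow_succ]
      congr 1
      ring

end Cantor

/-- The upper box dimension of a generalised Cantor set whose ratios are `q`, except at the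
positions `p k`, where the ratio is `q ^ (g k + 1)`. -/
theorem upperBoxDim_cantorSet {lam : ℕ → ℝ} {q : ℝ} (hq : q ∈ Ioo (0 : ℝ) (1 / 2))
    {p g : ℕ → ℕ} (hp : StrictMono p) (hp0 : 0 < p 0)
    (hlam : ∀ k i, i + 1 = p k → lam i = q ^ (g k + 1))
    (hlam' : ∀ i, (∀ k, i + 1 ≠ p k) → lam i = q) :
    upperBoxDim (cantorSet lam) = limsup (fun k : ℕ => -(Real.log 2 / Real.log q) *
      ((p k : ℝ) / (p k + ∑ j ∈ Finset.range k, (g j : ℝ)))) atTop := by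
  obtain ⟨hq0, hq2⟩ := hq
  have hl : Real.log q < 0 := Real.log_neg hq0 (by linarith)
  have hl2 : 0 < Real.log 2 := Real.log_pos one_lt_two
  set s := -(Real.log 2 / Real.log q) with hs
  have hs0 : 0 < s := by
    rw [hs, ← div_neg]
    exact div_pos hl2 (by linarith)
  have hlq : ∀ i, 0 < lam i ∧ lam i ≤ q := fun i => by
    by_cases h : ∃ k, i + 1 = p k
    · obtain ⟨k, hk⟩ := h
      rw [hlam k i hk]
      exact ⟨by positivity, pow_le_of_le_one hq0.le (by linarith) (by omega)⟩
    · push Not at h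
      rw [hlam' i h]
      exact ⟨hq0, le_rfl⟩
  have h0 : ∀ i, 0 < lam i := fun i => (hlq i).1
  have h1 : ∀ i, lam i ≤ 1 := fun i => by linarith [(hlq i).2]
  have hanti := cantorLen_antitone h0 h1
  have hlen := cantorLen_eq_pow hp hp0 hlam hlam'
  have hL0 : ∀ r : ℝ, 0 < r → ∃ n, cantorLen lam n ≤ r := fun r hr => by
    obtain ⟨n, hn⟩ := exists_pow_lt_of_lt_one hr (by linarith : q < 1)
    exact ⟨n, (cantorLen_le_pow h0 (fun i => (hlq i).2) n).trans hn.le⟩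
  set w : ℕ → ℝ := fun k => (p k : ℝ) / (p k + ∑ j ∈ Finset.range k, (g j : ℝ)) with hw
  have hpk : ∀ k, k < p k := fun k => by
    induction k with
    | zero => exact hp0
    | succ k ih =>
      have : p k < p (k + 1) := hp (Nat.lt_succ_self k)
      omega
  have hH : ∀ k, 0 ≤ ∑ j ∈ Finset.range k, (g j : ℝ) := fun k => by positivity
  have hw1 : ∀ k, w k ≤ 1 := fun k =>
    div_le_one_of_le₀ (by linarith [hH k]) (by have := hH k; positivity)
  have hw0 : ∀ k, 0 ≤ w k := fun k => by have := hH k; positivity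
  -- the covering exponent is controlled from above by `w`
  have hupper : ∀ N : ℕ, ∀ᶠ r in nhdsWithin (0 : ℝ) (Ioi 0), ∃ k, N ≤ k ∧
      Real.log (coverNum (cantorSet lam) r).toReal / (-Real.log r) ≤ s * w k + s / (N + 1) := by
    intro N
    have hN := cantorLen_pos h0 (p N)
    filter_upwards [Ioo_mem_nhdsGT hN] with r ⟨hr0, hr⟩
    have hex := hL0 r hr0
    have hfind : p N < Nat.find hex := by
      by_contra! h
      linarith [hanti h, Nat.find_spec hex]
    obtain ⟨n, hn⟩ : ∃ n, Nat.find hex = n + 1 := ⟨Nat.find hex - 1, by omega⟩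
    have hn1 : cantorLen lam (n + 1) ≤ r := hn ▸ Nat.find_spec hex
    have hn2 : r < cantorLen lam n := not_le.1 (Nat.find_min hex (by omega))
    have hexk : ∃ k, n < p k := ⟨n, hpk n⟩
    have hk1 := Nat.find_spec hexk
    have hk2 : ∀ j < Nat.find hexk, p j ≤ n := fun j hj => not_lt.1 (Nat.find_min hexk hj)
    generalize Nat.find hexk = k at hk1 hk2
    have hNk : N < k := hp.lt_iff_lt.1 (by omega)
    refine ⟨k, hNk.le, ?_⟩
    have hNn : N + 1 ≤ n := by have := hpk N; omega
    have hlogr : (n + ∑ j ∈ Finset.range k, (g j : ℝ)) * -Real.log q ≤ -Real.log r := by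
      have := Real.log_le_log hr0 hn2.le
      rw [hlen n k hk1 hk2, Real.log_pow] at this
      push_cast at this
      linarith
    have hH := hH k
    generalize hHd : ∑ j ∈ Finset.range k, (g j : ℝ) = H at *
    have hn0 : (N : ℝ) + 1 ≤ n := by exact_mod_cast hNn
    have hN0 : (0 : ℝ) ≤ N := N.cast_nonneg
    have hpkn : (n : ℝ) + 1 ≤ p k := by exact_mod_cast hk1
    have hpos : 0 < (n + H) * -Real.log q := mul_pos (by linarith) (by linarith)
    calc _ ≤ ((n + 1 : ℕ) * Real.log 2) / ((n + H) * -Real.log q) := by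
          gcongr
          exact log_coverNum_le h0 h1 hn1
      _ = s * ((n + 1) / (n + H)) := by
          rw [hs]
          have : (n + H) ≠ 0 := by linarith
          have := hl.ne
          push_cast
          field_simp
      _ ≤ s * ((n + 1) / (n + 1 + H) + 1 / (N + 1)) := by
          gcongr
          have e1 : (n + 1) / (n + H) - (n + 1) / (n + 1 + H) =
              ((n + 1) / (n + 1 + H)) * (1 / (n + H)) := by
            have : (n + H) ≠ 0 := by linarith
            have : (n + 1 + H) ≠ 0 := by linarith
            field_simp
            ring
          have e2 : ((n : ℝ) + 1) / (n + 1 + H) ≤ 1 :=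
            div_le_one_of_le₀ (by linarith) (by linarith)
          have e3 : 1 / (n + H) ≤ 1 / ((N : ℝ) + 1) :=
            one_div_le_one_div_of_le (by linarith) (by linarith)
          have e4 : 0 ≤ 1 / (n + H) := one_div_nonneg.2 (by linarith)
          have e5 := mul_le_mul e2 e3 e4 zero_le_one
          linarith
      _ ≤ s * (w k + 1 / (N + 1)) := by
          gcongr
          rw [hw]
          simp only [hHd]
          rw [div_le_div_iff₀ (by linarith) (by linarith)]
          nlinarith
      _ = _ := by ring
  have hbdd : IsBoundedUnder (· ≤ ·) (nhdsWithin (0 : ℝ) (Ioi 0))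
      fun r => Real.log (coverNum (cantorSet lam) r).toReal / (-Real.log r) := by
    refine ⟨s * 1 + s / ((0 : ℕ) + 1), ?_⟩
    rw [eventually_map]
    filter_upwards [hupper 0] with r ⟨k, _, hk⟩
    refine hk.trans ?_
    gcongr
    exact hw1 k
  apply le_antisymm
  · refine limsup_le_limsup_of_forall_pos ?_
      ⟨s * 1, eventually_map.2 (.of_forall fun k => by gcongr; exact hw1 k)⟩ ?_
    · filter_upwards [Ioo_mem_nhdsGT one_pos] with r ⟨hr0, hr1⟩
      obtain ⟨m, hm⟩ := hL0 r hr0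
      have := Real.log_neg hr0 hr1
      exact div_nonneg (by simpa using le_log_coverNum (n := 0) h0 h1 hm (by simp)) (by linarith)
    · intro ε hε t ht
      obtain ⟨K, hK⟩ := mem_atTop_sets.1 ht
      obtain ⟨M, hM⟩ := exists_nat_gt (s / ε)
      filter_upwards [hupper (max K M)] with r ⟨k, hk, hrk⟩
      refine ⟨k, hK k ((le_max_left _ _).trans hk), hrk.trans ?_⟩
      gcongr
      have hMM : (M : ℝ) ≤ (max K M : ℕ) := by exact_mod_cast le_max_right K M
      rw [div_lt_iff₀ hε] at hM
      rw [div_le_iff₀ (by positivity)]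
      nlinarith
  · refine limsup_le_limsup_of_forall_pos
      (.of_forall fun k => mul_nonneg hs0.le (hw0 k)) hbdd ?_
    intro ε hε t ht
    set c : ℝ := (1 - 2 * q) / 4 with hc
    have hc0 : 0 < c := by rw [hc]; linarith
    have hc1 : c < 1 := by rw [hc]; linarith
    have hlc : Real.log c < 0 := Real.log_neg hc0 hc1
    have hr : Tendsto (fun k => c * cantorLen lam (p k - 1)) atTop
        (nhdsWithin 0 (Ioi 0)) := by
      refine tendsto_nhdsWithin_iff.2
        ⟨?_, .of_forall fun k => mul_pos hc0 (cantorLen_pos h0 _)⟩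
      refine squeeze_zero (fun k => (mul_pos hc0 (cantorLen_pos h0 _)).le) (fun k => ?_)
        (tendsto_pow_atTop_nhds_zero_of_lt_one hq0.le (by linarith : q < 1))
      calc c * cantorLen lam (p k - 1) ≤ 1 * cantorLen lam k :=
            mul_le_mul hc1.le (hanti (by have := hpk k; omega)) (cantorLen_pos h0 _).le
              zero_le_one
        _ ≤ q ^ k := by
            rw [one_mul]
            exact cantorLen_le_pow h0 (fun i => (hlq i).2) k
    obtain ⟨M, hM⟩ := exists_nat_gt (s * (Real.log c / Real.log q) / ε)
    filter_upwards [hr ht, eventually_ge_atTop M] with k hkt hkM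
    refine ⟨_, hkt, ?_⟩
    obtain ⟨m, hm⟩ := hL0 _ (mul_pos hc0 (cantorLen_pos h0 (p k - 1)))
    have hpk1 : p k - 1 + 1 = p k := by have := hpk k; omega
    have hlog := le_log_coverNum (n := p k) h0 h1 hm (fun i hi => by
      have e1 := cantorLen_pos h0 i
      have e2 : cantorLen lam (p k - 1) ≤ cantorLen lam i := hanti (by omega)
      rw [cantorLen_succ lam i]
      have e3 := mul_le_mul_of_nonneg_left (hlq i).2 e1.le
      have e4 := mul_le_mul_of_nonneg_left e2 hc0.le
      rw [hc] at e4 ⊢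
      nlinarith)
    have hlogr : Real.log (c * cantorLen lam (p k - 1)) =
        Real.log c + (p k - 1 + ∑ j ∈ Finset.range k, (g j : ℝ)) * Real.log q := by
      rw [Real.log_mul hc0.ne' (cantorLen_pos h0 _).ne',
        hlen (p k - 1) k (by omega) fun j hj => by have := hp hj; omega, Real.log_pow]
      have : ((p k - 1 : ℕ) : ℝ) = p k - 1 := by
        rw [Nat.cast_sub (by omega)]
        simp
      push_cast
      rw [this]
    beta_reduce
    rw [hlogr]
    have hH := hH k
    generalize ∑ j ∈ Finset.range k, (g j : ℝ) = H at *
    have hMp : (M : ℝ) ≤ p k := by exact_mod_cast hkM.trans (hpk k).le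
    have hp1 : (1 : ℝ) ≤ p k := by exact_mod_cast (Nat.succ_le_of_lt (Nat.zero_lt_of_lt (hpk k)))
    generalize (p k : ℝ) = P at *
    set κ := Real.log c / Real.log q with hκ
    have hκ0 : 0 < κ := div_pos_of_neg_of_neg hlc hl
    have hκ' : Real.log c = κ * Real.log q := by
      rw [hκ]
      have := hl.ne
      field_simp
    have hD : 0 < P + H := by linarith
    rw [div_lt_iff₀ hε] at hM
    calc s * (P / (P + H)) ≤ s * (P / (κ + (P + H))) + ε := by
          have e1 : P / (P + H) - P / (κ + (P + H)) =
              (P / (κ + (P + H))) * (κ / (P + H)) := by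
            have : κ + (P + H) ≠ 0 := by linarith
            field_simp
            ring
          have e2 : P / (κ + (P + H)) ≤ 1 := div_le_one_of_le₀ (by linarith) (by linarith)
          have e4 : s * κ / (P + H) ≤ ε := by
            rw [div_le_iff₀ hD]
            nlinarith
          have e5 := mul_le_mul_of_nonneg_right e2 (div_pos hκ0 hD).le
          have e6 := mul_le_mul_of_nonneg_left e5 hs0.le
          rw [← e1] at e6
          have e7 : s * (1 * (κ / (P + H))) = s * κ / (P + H) := by ring
          linarith
      _ ≤ s * (P / (κ + (P - 1 + H))) + ε := by
          gcongr
          linarith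
      _ = P * Real.log 2 / -(Real.log c + (P - 1 + H) * Real.log q) + ε := by
          rw [hκ', hs, ← add_mul]
          have e1 : κ + (P - 1 + H) ≠ 0 := by linarith
          have := hl.ne
          field_simp
      _ ≤ _ := by
          gcongr
          nlinarith

/-- A variant of `upperBoxDim_cantorSet` in which the sequence of ratios may be shifted and
perturbed by a null sequence. -/
theorem upperBoxDim_cantorSet_of_tendsto {lam : ℕ → ℝ} {q : ℝ} (hq : q ∈ Ioo (0 : ℝ) (1 / 2))
    {p g : ℕ → ℕ} (hp : StrictMono p) (hp0 : 0 < p 0)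
    (hlam : ∀ k i, i + 1 = p k → lam i = q ^ (g k + 1))
    (hlam' : ∀ i, (∀ k, i + 1 ≠ p k) → lam i = q) {v : ℕ → ℝ}
    (hv : ∀ k, v k ∈ Icc (0 : ℝ) 1)
    (hlim : Tendsto (fun k : ℕ => (p k : ℝ) / (p k + ∑ j ∈ Finset.range k, (g j : ℝ)) - v (k + 1))
      atTop (nhds 0)) :
    upperBoxDim (cantorSet lam) = -(Real.log 2 / Real.log q) * limsup v atTop := by
  have hl : Real.log q < 0 := Real.log_neg hq.1 (by linarith [hq.2])
  have hs0 : 0 ≤ -(Real.log 2 / Real.log q) := by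
    rw [← div_neg]
    exact div_nonneg (Real.log_nonneg one_le_two) (by linarith)
  have hH : ∀ k, 0 ≤ ∑ j ∈ Finset.range k, (g j : ℝ) := fun k => by positivity
  have hw : ∀ k, (p k : ℝ) / (p k + ∑ j ∈ Finset.range k, (g j : ℝ)) ∈ Icc (0 : ℝ) 1 := fun k =>
    ⟨by have := hH k; positivity,
      div_le_one_of_le₀ (by linarith [hH k]) (by have := hH k; positivity)⟩
  rw [upperBoxDim_cantorSet hq hp hp0 hlam hlam', limsup_const_mul_of_mem_Icc hw hs0]
  congr 1
  have hclose : ∀ ε > 0, ∀ᶠ k in atTop,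
      |(p k : ℝ) / (p k + ∑ j ∈ Finset.range k, (g j : ℝ)) - v (k + 1)| < ε := fun ε hε => by
    simpa [Real.dist_eq] using Metric.tendsto_nhds.1 hlim ε hε
  have h1 := limsup_nat_add v 1
  rw [← h1]
  apply le_antisymm
  · refine limsup_le_limsup_of_forall_pos (.of_forall fun k => (hw k).1)
      ⟨1, eventually_map.2 (.of_forall fun k => (hv _).2)⟩ fun ε hε t ht => ?_
    filter_upwards [ht, hclose ε hε] with k hk hkε
    exact ⟨k, hk, by linarith [(abs_lt.1 hkε).2]⟩
  · refine limsup_le_limsup_of_forall_pos (.of_forall fun k => (hv _).1)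
      ⟨1, eventually_map.2 (.of_forall fun k => (hw _).2)⟩ fun ε hε t ht => ?_
    filter_upwards [ht, hclose ε hε] with k hk hkε
    exact ⟨k, hk, by linarith [(abs_lt.1 hkε).1]⟩

theorem sum_range_two_mul_add_one (a : ℕ → ℝ) (k : ℕ) :
    ∑ i ∈ Finset.range (2 * k + 1), a i =
      (∑ j ∈ Finset.range (k + 1), a (2 * j)) + ∑ j ∈ Finset.range k, a (2 * j + 1) := by
  induction k with
  | zero => simp
  | succ k ih =>
    rw [show 2 * (k + 1) + 1 = 2 * k + 1 + 1 + 1 by ring, Finset.sum_range_succ,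
      Finset.sum_range_succ, ih, Finset.sum_range_succ _ (k + 1),
      Finset.sum_range_succ (fun j => a (2 * j + 1)) k]
    ring_nf

theorem sum_range_two_mul (a : ℕ → ℝ) (k : ℕ) :
    ∑ i ∈ Finset.range (2 * k), a i =
      (∑ j ∈ Finset.range k, a (2 * j)) + ∑ j ∈ Finset.range k, a (2 * j + 1) := by
  have h := sum_range_two_mul_add_one a k
  rw [Finset.sum_range_succ, Finset.sum_range_succ] at h
  linarith

theorem strictMono_sum_range_succ {b : ℕ → ℕ} (hb : ∀ i, 0 < b i) (c : ℕ) :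
    StrictMono fun k => c + ∑ j ∈ Finset.range (k + 1), b j :=
  strictMono_nat_of_lt_succ fun k => by
    rw [Finset.sum_range_succ _ (k + 1)]
    have := hb (k + 1)
    omega

theorem upperBoxDim_cantorSet_lamSeq {q : ℝ} (hq : q ∈ Set.Ioo (0 : ℝ) (1 / 2))
    {a : ℕ → ℕ} (ha : ∀ i, 0 < a i) :
    upperBoxDim (cantorSet (lamSeq q a)) =
      -(Real.log 2 / Real.log q) *
        Filter.limsup (fun k : ℕ =>
          (∑ j ∈ Finset.range k, (a (2 * j) : ℝ)) /
            (∑ i ∈ Finset.range (2 * k - 1), (a i : ℝ))) Filter.atTop := by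
  have hp : StrictMono fun k => ∑ j ∈ Finset.range (k + 1), a (2 * j) := by
    simpa using strictMono_sum_range_succ (fun j => ha (2 * j)) 0
  refine upperBoxDim_cantorSet_of_tendsto hq (g := fun k => a (2 * k + 1)) hp
    (by simpa using ha 0) ?_ ?_ ?_ ?_
  · intro k i hk
    have h : ∃ k : ℕ, i + 1 = ∑ j ∈ Finset.range (k + 1), a (2 * j) := ⟨k, hk⟩
    have hck : h.choose = k := hp.injective (h.choose_spec.symm.trans hk)
    rw [lamSeq, dif_pos h, hck]
  · intro i hi
    rw [lamSeq, dif_neg (by push Not; exact hi)]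
  · intro k
    refine ⟨by positivity, ?_⟩
    rcases k with _ | k
    · simp
    · rw [show 2 * (k + 1) - 1 = 2 * k + 1 by omega, sum_range_two_mul_add_one]
      exact div_le_one_of_le₀ (le_add_of_nonneg_right (by positivity)) (by positivity)
  · refine tendsto_const_nhds.congr fun k => ?_
    rw [show 2 * (k + 1) - 1 = 2 * k + 1 by omega, sum_range_two_mul_add_one]
    push_cast
    simp

theorem upperBoxDim_cantorSet_muSeq {q : ℝ} (hq : q ∈ Set.Ioo (0 : ℝ) (1 / 2))
    {a : ℕ → ℕ} (ha : ∀ i, 0 < a i) :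
    upperBoxDim (cantorSet (muSeq q a)) =
      -(Real.log 2 / Real.log q) *
        Filter.limsup (fun k : ℕ =>
          (∑ j ∈ Finset.range k, (a (2 * j + 1) : ℝ)) /
            (∑ i ∈ Finset.range (2 * k), (a i : ℝ))) Filter.atTop := by
  have hp := strictMono_sum_range_succ (fun j => ha (2 * j + 1)) (a 0)
  refine upperBoxDim_cantorSet_of_tendsto hq (g := fun k => a (2 * k + 2)) hp
    (Nat.add_pos_left (ha 0) _) ?_ ?_ ?_ ?_
  · intro k i hk
    have h : ∃ k : ℕ, i + 1 = a 0 + ∑ j ∈ Finset.range (k + 1), a (2 * j + 1) := ⟨k, hk⟩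
    have hck : h.choose = k := hp.injective (h.choose_spec.symm.trans hk)
    rw [muSeq, dif_pos h, hck]
  · intro i hi
    rw [muSeq, dif_neg (by push Not; exact hi)]
  · intro k
    rw [sum_range_two_mul]
    exact ⟨by positivity,
      div_le_one_of_le₀ (le_add_of_nonneg_left (by positivity)) (by positivity)⟩
  · have hsum : ∀ k : ℕ, (k : ℝ) ≤ ∑ i ∈ Finset.range (2 * (k + 1)), (a i : ℝ) := fun k => by
      calc (k : ℝ) ≤ ∑ i ∈ Finset.range (2 * (k + 1)), (1 : ℝ) := by
            simp
            linarith [(k.cast_nonneg : (0 : ℝ) ≤ k)]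
        _ ≤ _ := Finset.sum_le_sum fun i _ => by exact_mod_cast ha i
    have hlim := (tendsto_atTop_mono hsum tendsto_natCast_atTop_atTop).const_div_atTop (a 0 : ℝ)
    refine hlim.congr fun k => ?_
    have e : ((a 0 + ∑ j ∈ Finset.range (k + 1), a (2 * j + 1) : ℕ) : ℝ) +
        ∑ j ∈ Finset.range k, (a (2 * j + 2) : ℝ) =
        ∑ i ∈ Finset.range (2 * (k + 1)), (a i : ℝ) := by
      rw [sum_range_two_mul, Finset.sum_range_succ' (fun j => (a (2 * j) : ℝ)) k]
      push_cast
      simp only [mul_add, mul_one]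
      ring
    rw [e, ← sub_div]
    push_cast
    ring

theorem statement15 (q : ℝ) (hq : q ∈ Set.Ioo (0 : ℝ) (1 / 2))
    (a : ℕ → ℕ) (ha : ∀ i, 0 < a i) :
    upperBoxDim (cantorSet (lamSeq q a)) =
        -(Real.log 2 / Real.log q) *
          Filter.limsup (fun k : ℕ =>
            (∑ j ∈ Finset.range k, (a (2 * j) : ℝ)) /
              (∑ i ∈ Finset.range (2 * k - 1), (a i : ℝ))) Filter.atTop ∧
      upperBoxDim (cantorSet (muSeq q a)) =
        -(Real.log 2 / Real.log q) *
          Filter.limsup (fun k : ℕ =>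
            (∑ j ∈ Finset.range k, (a (2 * j + 1) : ℝ)) /
              (∑ i ∈ Finset.range (2 * k), (a i : ℝ))) Filter.atTop :=
  ⟨upperBoxDim_cantorSet_lamSeq hq ha, upperBoxDim_cantorSet_muSeq hq ha⟩

end Paper
end

section
/- For every α, β ∈ (0,1) there exist generalised Cantor sets C, D ⊂ [0,1] such that dim_LB C = dim_B C = αβ, dim_LB D = dim_B D = α(1−β), and, with C×D ⊂ ℝ² carrying the Euclidean metric, dim_LB(C×D) = dim_B(C×D) = dim_A(C×D) = dim_A C = dim_A D = α. -/
open Metric Set Filter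
open scoped ENNReal NNReal

namespace Paper

/-- `F` branches into `2 ^ A t / 2 ^ A s` pieces, up to constants, between the scales
`q ^ s` and `q ^ t`, uniformly over `F`. -/
structure HasGrowth {X : Type*} [MetricSpace X] (F : Set X) (q : ℝ) (A : ℕ → ℕ) : Prop where
  nonempty : F.Nonempty
  subset_closedBall : ∀ x ∈ F, F ⊆ closedBall x 2
  exists_cover : ∃ K : ℕ, ∃ a : ℝ, 0 < a ∧ ∀ x ∈ F, ∀ s t : ℕ, s ≤ t →
    ∃ Q : Finset X, closedBall x (2 * q ^ s) ∩ F ⊆ ⋃ y ∈ Q, closedBall y (a * q ^ t) ∧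
      Q.card * 2 ^ A s ≤ K * 2 ^ A t
  exists_packing : ∃ K : ℕ, ∃ b : ℝ, 0 < b ∧ ∃ R : ℝ, 0 < R ∧ ∀ x ∈ F, ∀ s t : ℕ, s ≤ t →
    ∃ P : Finset X, (P : Set X) ⊆ closedBall x (R * q ^ s) ∩ F ∧
      2 ^ A t ≤ K * P.card * 2 ^ A s ∧ (P : Set X).Pairwise fun y z => b * q ^ t < dist y z

/-- Left endpoint of the level `n` interval with address `ε`. -/
noncomputable def cantorLeft (lam : ℕ → ℝ) (ε : ℕ → Bool) (n : ℕ) : ℝ :=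
  ∑ i ∈ Finset.range n, if ε i then cantorLen lam i - cantorLen lam (i + 1) else 0

theorem mem_cantorPre {lam : ℕ → ℝ} {n : ℕ} {x : ℝ} :
    x ∈ cantorPre lam n ↔
      ∃ ε, cantorLeft lam ε n ≤ x ∧ x ≤ cantorLeft lam ε n + cantorLen lam n := by
  simp only [cantorPre, Set.mem_iUnion, Set.mem_Icc, cantorLeft]

theorem cantorLeft_succ (lam : ℕ → ℝ) (ε : ℕ → Bool) (n : ℕ) :
    cantorLeft lam ε (n + 1) = cantorLeft lam ε n +
      if ε n then cantorLen lam n - cantorLen lam (n + 1) else 0 :=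
  Finset.sum_range_succ _ _

theorem cantorLeft_congr {lam : ℕ → ℝ} {ε η : ℕ → Bool} {n : ℕ} (h : ∀ i < n, ε i = η i) :
    cantorLeft lam ε n = cantorLeft lam η n :=
  Finset.sum_congr rfl fun i hi => by rw [h i (Finset.mem_range.1 hi)]

theorem cantorLeft_bounds {lam : ℕ → ℝ} (hL : Antitone (cantorLen lam)) (ε : ℕ → Bool)
    {m n : ℕ} (hmn : m ≤ n) :
    cantorLeft lam ε m ≤ cantorLeft lam ε n ∧
      cantorLeft lam ε n + cantorLen lam n ≤ cantorLeft lam ε m + cantorLen lam m := by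
  induction n, hmn using Nat.le_induction with
  | base => simp
  | succ n _ ih =>
    have h := hL (Nat.le_succ n)
    rw [cantorLeft_succ]
    split_ifs <;> constructor <;> simp only [Nat.succ_eq_add_one] at h <;> linarith

theorem cantorLen_gap_le_dist {lam : ℕ → ℝ} (hL : Antitone (cantorLen lam)) {ε η : ℕ → Bool}
    {n j : ℕ} {x y : ℝ} (hj : j < n) (hne : ε j ≠ η j) (heq : ∀ i < j, ε i = η i)
    (hx : cantorLeft lam ε n ≤ x ∧ x ≤ cantorLeft lam ε n + cantorLen lam n)
    (hy : cantorLeft lam η n ≤ y ∧ y ≤ cantorLeft lam η n + cantorLen lam n) :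
    cantorLen lam j - 2 * cantorLen lam (j + 1) ≤ dist x y := by
  have h1 := cantorLeft_bounds hL ε (Nat.succ_le_of_lt hj)
  have h2 := cantorLeft_bounds hL η (Nat.succ_le_of_lt hj)
  simp only [Nat.succ_eq_add_one, cantorLeft_succ, cantorLeft_congr heq] at h1 h2
  rw [Real.dist_eq]
  rcases hε : ε j <;> rcases hη : η j <;> simp [hε, hη] at hne h1 h2
  · rw [abs_sub_comm]; exact le_trans (by linarith) (le_abs_self _)
  · exact le_trans (by linarith) (le_abs_self _)

theorem exists_cantorLen_gap_le_dist {lam : ℕ → ℝ} (hL : Antitone (cantorLen lam))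
    {ε η : ℕ → Bool} {n : ℕ} {x y : ℝ} (hne : ∃ j < n, ε j ≠ η j)
    (hx : cantorLeft lam ε n ≤ x ∧ x ≤ cantorLeft lam ε n + cantorLen lam n)
    (hy : cantorLeft lam η n ≤ y ∧ y ≤ cantorLeft lam η n + cantorLen lam n) :
    ∃ j < n, ε j ≠ η j ∧ cantorLen lam j - 2 * cantorLen lam (j + 1) ≤ dist x y := by
  have hP : ∃ j, j < n ∧ ε j ≠ η j := hne
  obtain ⟨h1, h2⟩ := Nat.find_spec hP
  refine ⟨_, h1, h2, cantorLen_gap_le_dist hL h1 h2 (fun i hi => ?_) hx hy⟩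
  by_contra hc
  exact Nat.find_min hP hi ⟨hi.trans h1, hc⟩

theorem cantorLeft_mem_cantorSet {lam : ℕ → ℝ} (hL : Antitone (cantorLen lam))
    (h0 : ∀ n, 0 ≤ cantorLen lam n) {ε : ℕ → Bool} {n : ℕ} (hε : ∀ i, n ≤ i → ε i = false) :
    cantorLeft lam ε n ∈ cantorSet lam := by
  refine Set.mem_iInter.2 fun m => mem_cantorPre.2 ⟨ε, ?_⟩
  rcases le_total m n with h | h
  · have := cantorLeft_bounds hL ε h
    have := h0 n
    constructor <;> linarith
  · have : cantorLeft lam ε m = cantorLeft lam ε n := by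
      induction m, h using Nat.le_induction with
      | base => rfl
      | succ m hm ih => rw [cantorLeft_succ, ih, hε m hm]; simp
    have := h0 m
    constructor <;> linarith

theorem cantorSet_subset_Icc (lam : ℕ → ℝ) : cantorSet lam ⊆ Set.Icc 0 1 := by
  intro x hx
  obtain ⟨ε, h1, h2⟩ := mem_cantorPre.1 (Set.mem_iInter.1 hx 0)
  simp [cantorLeft, cantorLen] at h1 h2
  exact ⟨h1, h2⟩

/-- The address agreeing with `ε` below `k` and given by the finite set `T` from `k` on. -/
noncomputable def splice (ε : ℕ → Bool) (k : ℕ) (T : Finset ℕ) (i : ℕ) : Bool :=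
  if i < k then ε i else decide (i ∈ T)

theorem card_powerset_Ico_mul {k n : ℕ} (h : k ≤ n) :
    (Finset.Ico k n).powerset.card * 2 ^ k = 2 ^ n := by
  rw [Finset.card_powerset, Nat.card_Ico, ← pow_add, Nat.sub_add_cancel h]

/-- Contraction ratios giving level `n` intervals of length `q` to the power of the `n`-th
element of `p`, when `p 0` holds. -/
noncomputable def cantorRatio (q : ℝ) (p : ℕ → Prop) (i : ℕ) : ℝ :=
  q ^ (Nat.nth p (i + 1) - Nat.nth p i)

section cantorRatio

variable {q : ℝ} {p : ℕ → Prop}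

theorem cantorRatio_mem_Ioo (hq : 0 < q) (hq2 : q < 1 / 2) (hp : (Set.ofPred p).Infinite) (i : ℕ) :
    cantorRatio q p i ∈ Set.Ioo (0 : ℝ) (1 / 2) := by
  have h := Nat.nth_strictMono hp (Nat.lt_succ_self i)
  refine ⟨pow_pos hq _, lt_of_le_of_lt ?_ hq2⟩
  exact pow_le_of_le_one hq.le (by linarith) (by simp only [Nat.succ_eq_add_one] at h; omega)

theorem cantorLen_cantorRatio (hp : (Set.ofPred p).Infinite) (h0 : p 0) (n : ℕ) :
    cantorLen (cantorRatio q p) n = q ^ Nat.nth p n := by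
  induction n with
  | zero => simp [cantorLen, Nat.nth_zero_of_zero h0]
  | succ n ih =>
    have h := Nat.nth_strictMono hp (Nat.lt_succ_self n)
    simp only [Nat.succ_eq_add_one] at h
    rw [cantorLen, Finset.prod_range_succ, ← cantorLen, ih, cantorRatio, ← pow_add]
    congr 1
    omega

theorem hasGrowth_cantorSet [DecidablePred p] (hq : 0 < q) (hq2 : q < 1 / 2)
    (hp : (Set.ofPred p).Infinite) (h0 : p 0) :
    HasGrowth (cantorSet (cantorRatio q p)) q (Nat.count p) := by
  have hlen := cantorLen_cantorRatio (q := q) hp h0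
  have hmono := Nat.nth_strictMono hp
  have hL : Antitone (cantorLen (cantorRatio q p)) := by
    intro m n hmn
    rw [hlen, hlen]
    exact pow_le_pow_of_le_one hq.le (by linarith) (hmono.monotone hmn)
  have hpos : ∀ n, 0 ≤ cantorLen (cantorRatio q p) n := fun n => by rw [hlen]; positivity
  have hgap : ∀ j, (1 - 2 * q) * q ^ Nat.nth p j ≤
      cantorLen (cantorRatio q p) j - 2 * cantorLen (cantorRatio q p) (j + 1) := by
    intro j
    have h1 : Nat.nth p j + 1 ≤ Nat.nth p (j + 1) := hmono (Nat.lt_succ_self j)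
    have h2 : q ^ Nat.nth p (j + 1) ≤ q ^ (Nat.nth p j + 1) :=
      pow_le_pow_of_le_one hq.le (by linarith) h1
    rw [hlen, hlen]
    rw [pow_succ] at h2
    linarith
  have hc : 0 < 1 - 2 * q := by linarith
  refine ⟨⟨0, ?_⟩, ?_, ?_, ?_⟩
  · have := cantorLeft_mem_cantorSet hL hpos (ε := fun _ => false) (n := 0) (by simp)
    simpa [cantorLeft] using this
  · intro x hx y hy
    have h1 := cantorSet_subset_Icc _ hx
    have h2 := cantorSet_subset_Icc _ hy
    rw [mem_closedBall, Real.dist_eq, abs_le]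
    constructor <;> linarith [h1.1, h1.2, h2.1, h2.2]
  · obtain ⟨m, hm⟩ := exists_pow_lt_of_lt_one (half_pos hc) (by linarith : q < 1)
    refine ⟨2 ^ m, 1, one_pos, fun x hx s t hst => ?_⟩
    set k := Nat.count p (s - m) with hk
    set n := Nat.count p t with hn
    have hkn : k ≤ n := Nat.count_monotone p (by omega)
    obtain ⟨ε, hε⟩ := mem_cantorPre.1 (Set.mem_iInter.1 hx n)
    refine ⟨(Finset.Ico k n).powerset.image
      fun T => cantorLeft (cantorRatio q p) (splice ε k T) n, ?_, ?_⟩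
    · rintro y ⟨hyx, hy⟩
      obtain ⟨η, hη⟩ := mem_cantorPre.1 (Set.mem_iInter.1 hy n)
      have hagree : ∀ i < k, ε i = η i := by
        by_contra! hne
        have hk' := cantorLeft_bounds hL ε hkn
        have hk'' := cantorLeft_bounds hL η hkn
        obtain ⟨j, hj, -, hd⟩ := exists_cantorLen_gap_le_dist hL hne
          (x := x) (y := y) (by constructor <;> linarith [hε.1, hε.2])
          (by constructor <;> linarith [hη.1, hη.2])
        have hjs : m + Nat.nth p j ≤ s := by
          have := Nat.nth_lt_of_lt_count hj
          omega
        have h1 : q ^ s ≤ q ^ m * q ^ Nat.nth p j := by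
          rw [← pow_add]
          exact pow_le_pow_of_le_one hq.le (by linarith) hjs
        have h2 := hgap j
        have h3 : q ^ m * q ^ Nat.nth p j < (1 - 2 * q) / 2 * q ^ Nat.nth p j :=
          mul_lt_mul_of_pos_right hm (by positivity)
        rw [mem_closedBall, dist_comm] at hyx
        linarith
      simp only [Finset.mem_image, Set.mem_iUnion, exists_prop]
      refine ⟨_, ⟨(Finset.Ico k n).filter (fun i => η i = true), by simp, rfl⟩, ?_⟩
      have : cantorLeft (cantorRatio q p)
          (splice ε k ((Finset.Ico k n).filter (fun i => η i = true))) n =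
          cantorLeft (cantorRatio q p) η n := by
        refine cantorLeft_congr fun i hi => ?_
        unfold splice
        split_ifs with hik
        · exact hagree i hik
        · simp [hi, not_lt.1 hik]
      rw [this, mem_closedBall, Real.dist_eq, one_mul]
      have h4 : cantorLen (cantorRatio q p) n ≤ q ^ t := by
        rw [hlen]
        exact pow_le_pow_of_le_one hq.le (by linarith) (Nat.le_nth_count hp t)
      rw [abs_of_nonneg (by linarith [hη.1])]
      linarith [hη.2]
    · have hks : Nat.count p s ≤ k + m := by
        have h1 : Nat.count p s ≤ Nat.count p (s - m + m) := Nat.count_monotone p (by omega)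
        rw [Nat.count_add] at h1
        exact h1.trans (Nat.add_le_add_left (Nat.count_le _) _)
      calc _ ≤ (Finset.Ico k n).powerset.card * 2 ^ (k + m) :=
            Nat.mul_le_mul Finset.card_image_le (Nat.pow_le_pow_right two_pos hks)
        _ = 2 ^ m * ((Finset.Ico k n).powerset.card * 2 ^ k) := by ring
        _ = _ := by rw [card_powerset_Ico_mul hkn]
  · refine ⟨1, 1 - 2 * q, hc, 1, one_pos, fun x hx s t hst => ?_⟩
    set k := Nat.count p s with hk
    set n := Nat.count p t with hn
    have hkn : k ≤ n := Nat.count_monotone p hst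
    obtain ⟨ε, hε⟩ := mem_cantorPre.1 (Set.mem_iInter.1 hx k)
    have hsep : ∀ T ∈ (Finset.Ico k n).powerset, ∀ U ∈ (Finset.Ico k n).powerset, T ≠ U →
        (1 - 2 * q) * q ^ t < dist (cantorLeft (cantorRatio q p) (splice ε k T) n)
          (cantorLeft (cantorRatio q p) (splice ε k U) n) := by
      intro T hT U hU hTU
      rw [Finset.mem_powerset] at hT hU
      have hne : ∃ j < n, splice ε k T j ≠ splice ε k U j := by
        by_contra! h
        refine hTU (Finset.ext fun i => ?_)
        by_cases hi : i ∈ Finset.Ico k n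
        · have := h i (Finset.mem_Ico.1 hi).2
          simpa [splice, not_lt.2 (Finset.mem_Ico.1 hi).1] using this
        · exact iff_of_false (fun h => hi (hT h)) fun h => hi (hU h)
      have hn0 := hpos n
      obtain ⟨j, hj, -, hd⟩ := exists_cantorLen_gap_le_dist hL hne
        ⟨le_rfl, by linarith⟩ ⟨le_rfl, by linarith⟩
      refine lt_of_lt_of_le (lt_of_lt_of_le ?_ (hgap j)) hd
      exact mul_lt_mul_of_pos_left
        (pow_lt_pow_right_of_lt_one₀ hq (by linarith) (Nat.nth_lt_of_lt_count hj)) hc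
    refine ⟨(Finset.Ico k n).powerset.image
      fun T => cantorLeft (cantorRatio q p) (splice ε k T) n, ?_, ?_, ?_⟩
    · intro y hy
      simp only [Finset.coe_image, Set.mem_image, Finset.mem_coe, Finset.mem_powerset] at hy
      obtain ⟨T, hT, rfl⟩ := hy
      constructor
      · have h1 := cantorLeft_bounds hL (splice ε k T) hkn
        have h2 : cantorLeft (cantorRatio q p) (splice ε k T) k =
            cantorLeft (cantorRatio q p) ε k :=
          cantorLeft_congr fun i hi => by simp [splice, hi]
        have h3 : cantorLen (cantorRatio q p) k ≤ q ^ s := by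
          rw [hlen]
          exact pow_le_pow_of_le_one hq.le (by linarith) (Nat.le_nth_count hp s)
        have := hpos n
        rw [mem_closedBall, Real.dist_eq, one_mul, abs_le]
        constructor <;> linarith [hε.1, hε.2, h1.1, h1.2]
      · refine cantorLeft_mem_cantorSet hL hpos fun i hi => ?_
        have : i ∉ T := fun h => by
          have := Finset.mem_Ico.1 (hT h)
          omega
        simp [splice, this, not_lt.2 (hkn.trans hi)]
    · rw [Finset.card_image_of_injOn, one_mul, card_powerset_Ico_mul hkn]
      intro T hT U hU h
      by_contra hTU
      have := hsep T hT U hU hTU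
      simp only at h
      rw [h, dist_self] at this
      exact absurd this (not_lt.2 (by positivity))
    · intro y hy z hz hyz
      simp only [Finset.coe_image, Set.mem_image, Finset.mem_coe] at hy hz
      obtain ⟨T, hT, rfl⟩ := hy
      obtain ⟨U, hU, rfl⟩ := hz
      exact hsep T hT U hU fun h => hyz (by rw [h])

end cantorRatio

section coverNum

variable {X : Type*} [MetricSpace X] {F G : Set X} {r : ℝ}

theorem coverNum_le {Q : Finset X} (h : F ⊆ ⋃ y ∈ Q, closedBall y r) :
    coverNum F r ≤ (Q.card : ℝ≥0∞) :=
  iInf₂_le Q h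

theorem card_le_coverNum {P : Finset X} (hP : (P : Set X) ⊆ F)
    (hd : (P : Set X).Pairwise fun y z => 2 * r < dist y z) :
    (P.card : ℝ≥0∞) ≤ coverNum F r := by
  refine le_iInf₂ fun s hs => ?_
  have hex : ∀ y ∈ P, ∃ z ∈ s, y ∈ closedBall z r := fun y hy => by
    simpa using hs (hP hy)
  choose! f hfs hf using hex
  refine Nat.cast_le.2 (Finset.card_le_card_of_injOn f hfs fun y hy z hz hyz => ?_)
  by_contra hne
  have h1 := hf y hy
  have h2 := hf z hz
  rw [hyz] at h1
  have := dist_triangle_right y z (f z)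
  rw [mem_closedBall] at h1 h2
  linarith [hd hy hz hne]

end coverNum

namespace HasGrowth

section General

variable {X : Type*} [MetricSpace X] {F : Set X} {q : ℝ} {A B : ℕ → ℕ}

theorem congr (h : HasGrowth F q A) {c : ℕ} (hAB : ∀ t, A t ≤ B t + c)
    (hBA : ∀ t, B t ≤ A t + c) : HasGrowth F q B := by
  have hA : ∀ t, 2 ^ A t ≤ 2 ^ B t * 2 ^ c := fun t => by
    rw [← pow_add]; exact Nat.pow_le_pow_right two_pos (hAB t)
  have hB : ∀ t, 2 ^ B t ≤ 2 ^ A t * 2 ^ c := fun t => by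
    rw [← pow_add]; exact Nat.pow_le_pow_right two_pos (hBA t)
  obtain ⟨K, a, ha, hK⟩ := h.exists_cover
  obtain ⟨L, b, hb, R, hR, hL⟩ := h.exists_packing
  refine ⟨h.nonempty, h.subset_closedBall, ⟨K * 2 ^ c * 2 ^ c, a, ha, fun x hx s t hst => ?_⟩,
    ⟨L * 2 ^ c * 2 ^ c, b, hb, R, hR, fun x hx s t hst => ?_⟩⟩
  · obtain ⟨Q, hQ, hc⟩ := hK x hx s t hst
    refine ⟨Q, hQ, ?_⟩
    calc Q.card * 2 ^ B s ≤ Q.card * (2 ^ A s * 2 ^ c) := Nat.mul_le_mul_left _ (hB s)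
      _ = (Q.card * 2 ^ A s) * 2 ^ c := by ring
      _ ≤ (K * (2 ^ B t * 2 ^ c)) * 2 ^ c :=
        Nat.mul_le_mul_right _ (hc.trans (Nat.mul_le_mul_left _ (hA t)))
      _ = _ := by ring
  · obtain ⟨P, hP, hc, hd⟩ := hL x hx s t hst
    refine ⟨P, hP, ?_, hd⟩
    calc 2 ^ B t ≤ (L * P.card * 2 ^ A s) * 2 ^ c := (hB t).trans (Nat.mul_le_mul_right _ hc)
      _ ≤ (L * P.card * (2 ^ B s * 2 ^ c)) * 2 ^ c :=
        Nat.mul_le_mul_right _ (Nat.mul_le_mul_left _ (hA s))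
      _ = _ := by ring

theorem exists_coverNum_bounds (h : HasGrowth F q A) (hq : 0 < q) (hq1 : q < 1)
    (hA : ∀ s m, A (s + m) ≤ A s + m) :
    ∃ K : ℝ, 0 < K ∧ ∃ m : ℕ, ∀ n ≥ m, ∀ r : ℝ, q ^ (n + 1) < r → r ≤ q ^ n →
      (2 : ℝ) ^ A n ≤ K * (coverNum F r).toReal ∧ (coverNum F r).toReal ≤ K * 2 ^ A n := by
  obtain ⟨K, a, ha, hK⟩ := h.exists_cover
  obtain ⟨L, b, hb, R, hR, hL⟩ := h.exists_packing
  obtain ⟨x, hx⟩ := h.nonempty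
  obtain ⟨m₁, hm₁⟩ := exists_pow_lt_of_lt_one (inv_pos.2 ha) hq1
  obtain ⟨m₂, hm₂⟩ := exists_pow_lt_of_lt_one (half_pos hb) hq1
  refine ⟨K * 2 ^ (m₁ + 1) + L * 2 ^ (m₂ + A 0) + 1, by positivity, m₂, fun n hn r hr1 hr2 => ?_⟩
  obtain ⟨Q, hQ, hQc⟩ := hK x hx 0 (n + (m₁ + 1)) (Nat.zero_le _)
  obtain ⟨P, hP, hPc, hPd⟩ := hL x hx 0 (n - m₂) (Nat.zero_le _)
  have hup : coverNum F r ≤ (Q.card : ℝ≥0∞) := by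
    refine coverNum_le fun y hy => ?_
    have := hQ ⟨by simpa using h.subset_closedBall x hx hy, hy⟩
    simp only [Set.mem_iUnion, exists_prop] at this ⊢
    obtain ⟨z, hz, hyz⟩ := this
    refine ⟨z, hz, closedBall_subset_closedBall ?_ hyz⟩
    have h1 : a * q ^ m₁ ≤ 1 := by
      calc a * q ^ m₁ ≤ a * a⁻¹ := by gcongr
        _ = 1 := mul_inv_cancel₀ ha.ne'
    calc a * q ^ (n + (m₁ + 1)) = (a * q ^ m₁) * q ^ (n + 1) := by ring
      _ ≤ 1 * q ^ (n + 1) := by gcongr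
      _ ≤ r := by linarith
  have hlow : (P.card : ℝ≥0∞) ≤ coverNum F r := by
    refine card_le_coverNum (fun y hy => (hP hy).2) fun y hy z hz hyz => ?_
    refine lt_of_le_of_lt ?_ (hPd hy hz hyz)
    have h2 : q ^ n = q ^ m₂ * q ^ (n - m₂) := by rw [← pow_add]; congr 1; omega
    have h3 : q ^ m₂ * q ^ (n - m₂) ≤ b / 2 * q ^ (n - m₂) := by gcongr
    linarith
  have htop : coverNum F r ≠ ⊤ := ne_top_of_le_ne_top (ENNReal.natCast_ne_top _) hup
  have hup' : (coverNum F r).toReal ≤ Q.card := by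
    simpa using ENNReal.toReal_mono (ENNReal.natCast_ne_top _) hup
  have hlow' : (P.card : ℝ) ≤ (coverNum F r).toReal := by
    simpa using ENNReal.toReal_mono htop hlow
  have hQ' : (Q.card : ℝ) ≤ K * 2 ^ (m₁ + 1) * 2 ^ A n := by
    have : Q.card ≤ K * 2 ^ (m₁ + 1) * 2 ^ A n := by
      calc Q.card ≤ Q.card * 2 ^ A 0 := Nat.le_mul_of_pos_right _ (by positivity)
        _ ≤ K * 2 ^ A (n + (m₁ + 1)) := hQc
        _ ≤ K * 2 ^ (A n + (m₁ + 1)) :=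
          Nat.mul_le_mul_left _ (Nat.pow_le_pow_right two_pos (hA _ _))
        _ = _ := by ring
    exact_mod_cast this
  have hP' : (2 : ℝ) ^ A n ≤ L * 2 ^ (m₂ + A 0) * P.card := by
    have : 2 ^ A n ≤ L * 2 ^ (m₂ + A 0) * P.card := by
      calc 2 ^ A n = 2 ^ A (n - m₂ + m₂) := by rw [Nat.sub_add_cancel hn]
        _ ≤ 2 ^ (A (n - m₂) + m₂) := Nat.pow_le_pow_right two_pos (hA _ _)
        _ = 2 ^ A (n - m₂) * 2 ^ m₂ := by ring
        _ ≤ (L * P.card * 2 ^ A 0) * 2 ^ m₂ := Nat.mul_le_mul_right _ hPc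
        _ = _ := by ring
    exact_mod_cast this
  have hN : 0 ≤ (coverNum F r).toReal := ENNReal.toReal_nonneg
  constructor
  · calc (2 : ℝ) ^ A n ≤ L * 2 ^ (m₂ + A 0) * P.card := hP'
      _ ≤ L * 2 ^ (m₂ + A 0) * (coverNum F r).toReal := by gcongr
      _ ≤ _ := by
        gcongr
        have : (0 : ℝ) ≤ K * 2 ^ (m₁ + 1) := by positivity
        linarith
  · refine (hup'.trans hQ').trans ?_
    gcongr
    have : (0 : ℝ) ≤ L * 2 ^ (m₂ + A 0) := by positivity
    linarith

theorem tendsto_log_coverNum (h : HasGrowth F q A) (hq : 0 < q) (hq1 : q < 1)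
    (hA : ∀ s m, A (s + m) ≤ A s + m) {θ : ℝ}
    (hθ : Tendsto (fun n : ℕ => (A n : ℝ) / n) atTop (nhds θ)) :
    Tendsto (fun r : ℝ => Real.log (coverNum F r).toReal / (-Real.log r))
      (nhdsWithin 0 (Set.Ioi 0)) (nhds (θ * Real.log 2 / (-Real.log q))) := by
  obtain ⟨K, hK, m, hm⟩ := h.exists_coverNum_bounds hq hq1 hA
  have hlq : Real.log q < 0 := Real.log_neg hq hq1
  set y : ℝ → ℝ := fun r => Real.log r / Real.log q with hy
  have hyt : Tendsto y (nhdsWithin 0 (Set.Ioi 0)) atTop :=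
    (tendsto_div_const_atTop_of_neg hlq).2 Real.tendsto_log_nhdsGT_zero
  have hfl : Tendsto (fun r => ⌊y r⌋₊) (nhdsWithin 0 (Set.Ioi 0)) atTop :=
    tendsto_nat_floor_atTop.comp hyt
  have h1 : Tendsto (fun r => (A ⌊y r⌋₊ : ℝ) / ⌊y r⌋₊ * (⌊y r⌋₊ / y r))
      (nhdsWithin 0 (Set.Ioi 0)) (nhds (θ * 1)) :=
    (hθ.comp hfl).mul ((tendsto_nat_floor_div_atTop (R := ℝ)).comp hyt)
  have hbd : ∀ᶠ r in nhdsWithin (0 : ℝ) (Set.Ioi 0),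
      |Real.log (coverNum F r).toReal - A ⌊y r⌋₊ * Real.log 2| ≤ Real.log K := by
    filter_upwards [hfl.eventually_ge_atTop m, hyt.eventually_ge_atTop 0,
      self_mem_nhdsWithin] with r hr hy0 hr0
    have hr0' : 0 < r := hr0
    have hlr : Real.log r = y r * Real.log q := (div_mul_cancel₀ _ hlq.ne).symm
    have e1 : q ^ (⌊y r⌋₊ + 1) < r := by
      rw [← Real.log_lt_log_iff (by positivity) hr0', Real.log_pow, hlr]
      push_cast
      exact mul_lt_mul_of_neg_right (Nat.lt_floor_add_one _) hlq
    have e2 : r ≤ q ^ ⌊y r⌋₊ := by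
      rw [← Real.log_le_log_iff hr0' (by positivity), Real.log_pow, hlr]
      exact mul_le_mul_of_nonpos_right (Nat.floor_le hy0) hlq.le
    obtain ⟨g1, g2⟩ := hm _ hr r e1 e2
    have hN : 0 < (coverNum F r).toReal := by
      by_contra hc
      have hz : (coverNum F r).toReal = 0 := le_antisymm (not_lt.1 hc) ENNReal.toReal_nonneg
      rw [hz, mul_zero] at g1
      exact absurd g1 (not_le.2 (by positivity))
    have g1' := Real.log_le_log (by positivity) g1
    have g2' := Real.log_le_log hN g2
    rw [Real.log_mul hK.ne' hN.ne', Real.log_pow] at g1'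
    rw [Real.log_mul hK.ne' (by positivity), Real.log_pow] at g2'
    rw [abs_le]
    constructor <;> linarith
  have h2 : Tendsto (fun r => (Real.log (coverNum F r).toReal - A ⌊y r⌋₊ * Real.log 2) / y r)
      (nhdsWithin 0 (Set.Ioi 0)) (nhds 0) := by
    refine tendsto_bdd_div_atTop_nhds_zero (b := -Real.log K) (B := Real.log K) ?_ ?_ hyt
    · filter_upwards [hbd] with r hr using (abs_le.1 hr).1
    · filter_upwards [hbd] with r hr using (abs_le.1 hr).2
  have h3 := (h2.add (h1.mul_const (Real.log 2))).div_const (-Real.log q)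
  rw [zero_add, mul_one] at h3
  refine h3.congr' ?_
  filter_upwards [hyt.eventually_gt_atTop 0, hfl.eventually_gt_atTop 0] with r hy0 hf0
  have hf0' : (⌊y r⌋₊ : ℝ) ≠ 0 := by exact_mod_cast hf0.ne'
  have hlr : Real.log r = y r * Real.log q := (div_mul_cancel₀ _ hlq.ne).symm
  have hq0 := hlq.ne
  have hy0' := hy0.ne'
  rw [hlr]
  field_simp
  ring

theorem boxDim_eq (h : HasGrowth F q A) (hq : 0 < q) (hq1 : q < 1)
    (hA : ∀ s m, A (s + m) ≤ A s + m) {θ : ℝ}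
    (hθ : Tendsto (fun n : ℕ => (A n : ℝ) / n) atTop (nhds θ)) :
    lowerBoxDim F = θ * Real.log 2 / (-Real.log q) ∧
      upperBoxDim F = θ * Real.log 2 / (-Real.log q) :=
  ⟨(h.tendsto_log_coverNum hq hq1 hA hθ).liminf_eq,
    (h.tendsto_log_coverNum hq hq1 hA hθ).limsup_eq⟩

theorem isHomogeneous (h : HasGrowth F q A) (hq : 0 < q) (hq1 : q < 1)
    (hA : ∀ s m, A (s + m) ≤ A s + m) {α : ℝ} (hα : 0 ≤ α) (hqα : q⁻¹ ^ α = 2) :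
    IsHomogeneous F α := by
  intro δ₀ hδ₀
  obtain ⟨K, a, ha, hK⟩ := h.exists_cover
  set c := min (q / a) (1 / δ₀) with hc
  have hc0 : 0 < c := by positivity
  refine ⟨K * (1 + (1 / (q * c)) ^ α) + 1, by positivity, fun x hx δ ρ hρ hρδ hδ => ?_⟩
  have hδ0 : 0 < δ := hρ.trans hρδ
  obtain ⟨s, hs, hsδ⟩ : ∃ s : ℕ, closedBall x δ ∩ F ⊆ closedBall x (2 * q ^ s) ∩ F ∧
      q * q ^ s ≤ δ := by
    rcases le_total 1 δ with h1 | h1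
    · exact ⟨0, fun y hy => ⟨by simpa using h.subset_closedBall x hx hy.2, hy.2⟩,
        by simpa using by linarith⟩
    · obtain ⟨s, hs1, hs2⟩ := exists_nat_pow_near_of_lt_one hδ0 h1 hq hq1
      refine ⟨s, Set.inter_subset_inter_left _ (closedBall_subset_closedBall ?_), ?_⟩
      · have : 0 < q ^ s := by positivity
        linarith
      · rw [pow_succ] at hs1; linarith
  obtain ⟨t, ht1, ht2⟩ : ∃ t : ℕ, a * q ^ t ≤ ρ ∧ c * ρ ≤ q ^ t := by
    rcases le_total a ρ with h1 | h1
    · refine ⟨0, by simpa using h1, ?_⟩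
      calc c * ρ ≤ 1 / δ₀ * δ₀ := by
            gcongr
            · exact min_le_right _ _
            · linarith
        _ = q ^ 0 := by rw [one_div, inv_mul_cancel₀ hδ₀.ne', pow_zero]
    · obtain ⟨n, hn1, hn2⟩ := exists_nat_pow_near_of_lt_one (div_pos hρ ha)
        ((div_le_one ha).2 h1) hq hq1
      refine ⟨n + 1, ?_, ?_⟩
      · rw [lt_div_iff₀ ha] at hn1; linarith
      · calc c * ρ ≤ q / a * ρ := by gcongr; exact min_le_left _ _
          _ = q * (ρ / a) := by ring
          _ ≤ q * q ^ n := by gcongr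
          _ = _ := by ring
  have hcov : ∀ t', s ≤ t' → a * q ^ t' ≤ ρ →
      coverNum (closedBall x δ ∩ F) ρ ≤ ENNReal.ofReal (K * 2 ^ (t' - s)) := by
    intro t' hst ht'
    obtain ⟨Q, hQ, hQc⟩ := hK x hx s t' hst
    have h1 : Q.card ≤ K * 2 ^ (t' - s) := by
      refine Nat.le_of_mul_le_mul_right (c := 2 ^ A s) ?_ (by positivity)
      have := hA s (t' - s)
      rw [Nat.add_sub_cancel' hst] at this
      calc _ ≤ K * 2 ^ A t' := hQc
        _ ≤ K * 2 ^ (A s + (t' - s)) := by gcongr; norm_num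
        _ = _ := by ring
    have h2 : coverNum (closedBall x δ ∩ F) ρ ≤ (Q.card : ℝ≥0∞) :=
      coverNum_le ((hs.trans hQ).trans
        (Set.iUnion₂_mono fun y _ => closedBall_subset_closedBall ht'))
    rw [← ENNReal.ofReal_natCast] at h2
    refine h2.trans (ENNReal.ofReal_le_ofReal ?_)
    exact_mod_cast h1
  have hpow : 0 < (δ / ρ) ^ α := by positivity
  have hc' : 0 < (1 / (q * c)) ^ α := by positivity
  rcases le_total s t with hst | hst
  · refine (hcov t hst ht1).trans (ENNReal.ofReal_le_ofReal ?_)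
    have h1 : (2 : ℝ) ^ (t - s) = (q ^ s / q ^ t) ^ α := by
      rw [← hqα, Real.rpow_pow_comm (by positivity)]
      congr 1
      rw [inv_pow, pow_sub₀ q hq.ne' hst]
      field_simp
    have h2 : (q ^ s / q ^ t) ^ α ≤ (1 / (q * c)) ^ α * (δ / ρ) ^ α := by
      rw [← Real.mul_rpow (by positivity) (by positivity)]
      refine Real.rpow_le_rpow (by positivity) ?_ hα
      calc q ^ s / q ^ t ≤ (δ / q) / (c * ρ) := by
            gcongr
            rw [le_div_iff₀ hq]; linarith
        _ = _ := by field_simp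
    rw [h1]
    calc K * (q ^ s / q ^ t) ^ α ≤ K * ((1 / (q * c)) ^ α * (δ / ρ) ^ α) := by gcongr
      _ = (K * (1 / (q * c)) ^ α) * (δ / ρ) ^ α := by ring
      _ ≤ _ := by
        gcongr
        have : (0 : ℝ) ≤ K := by positivity
        nlinarith
  · refine (hcov s le_rfl (le_trans ?_ ht1)).trans (ENNReal.ofReal_le_ofReal ?_)
    · gcongr 1
      exact pow_le_pow_of_le_one hq.le hq1.le hst
    · have h1 : 1 ≤ (δ / ρ) ^ α := Real.one_le_rpow ((one_le_div hρ).2 hρδ.le) hα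
      simp only [Nat.sub_self, pow_zero, mul_one]
      have hK0 : (0 : ℝ) ≤ K := by positivity
      nlinarith [mul_nonneg hK0 hc'.le]

theorem le_of_isHomogeneous (h : HasGrowth F q A) (hq : 0 < q) (hq1 : q < 1)
    (hrun : ∀ m, ∃ s, A (s + m) = A s + m) {α s' : ℝ} (hqα : q⁻¹ ^ α = 2)
    (hs' : IsHomogeneous F s') : α ≤ s' := by
  by_contra! hlt
  obtain ⟨L, b, hb, R, hR, hL⟩ := h.exists_packing
  obtain ⟨x, hx⟩ := h.nonempty
  obtain ⟨C, hC, hhom⟩ := hs' R hR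
  set ξ := 2 / q⁻¹ ^ s' with hξ
  have hqi : 1 < q⁻¹ := (one_lt_inv₀ hq).2 hq1
  have hξ1 : 1 < ξ := by
    rw [hξ, one_lt_div (by positivity), ← hqα]
    exact Real.rpow_lt_rpow_of_exponent_lt hqi hlt
  obtain ⟨m₀, hm₀⟩ := exists_pow_lt_of_lt_one (div_pos (mul_pos two_pos hR) hb) hq1
  obtain ⟨m₁, hm₁⟩ := pow_unbounded_of_one_lt (L * C * (2 * R / b) ^ s') hξ1
  set m := m₀ + m₁ with hm
  obtain ⟨s, hs⟩ := hrun m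
  obtain ⟨P, hP, hPc, hPd⟩ := hL x hx s (s + m) (Nat.le_add_right _ _)
  have hcard : (2 : ℝ) ^ m ≤ L * P.card := by
    rw [hs, pow_add, mul_comm] at hPc
    have := Nat.le_of_mul_le_mul_right hPc (by positivity)
    exact_mod_cast this
  have hqs : 0 < q ^ s := by positivity
  have hρδ : b * q ^ (s + m) / 2 < R * q ^ s := by
    have h1 : q ^ m ≤ q ^ m₀ := pow_le_pow_of_le_one hq.le hq1.le (Nat.le_add_right _ _)
    have h2 := h1.trans_lt hm₀
    rw [lt_div_iff₀ hb] at h2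
    rw [pow_add]
    nlinarith
  have h1 := hhom x hx (R * q ^ s) (b * q ^ (s + m) / 2) (by positivity) hρδ
    (mul_le_of_le_one_right hR.le (pow_le_one₀ hq.le hq1.le))
  have h2 := (card_le_coverNum hP (r := b * q ^ (s + m) / 2) fun y hy z hz hyz => by
    have := hPd hy hz hyz
    linarith).trans h1
  rw [← ENNReal.ofReal_natCast, ENNReal.ofReal_le_ofReal_iff (by positivity)] at h2
  have h3 : R * q ^ s / (b * q ^ (s + m) / 2) = (2 * R / b) * q⁻¹ ^ m := by
    rw [pow_add, inv_pow]
    field_simp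
  rw [h3, Real.mul_rpow (by positivity) (by positivity), ← Real.rpow_pow_comm (by positivity)]
    at h2
  have h4 : ξ ^ m ≤ L * C * (2 * R / b) ^ s' := by
    rw [hξ, div_pow, div_le_iff₀ (by positivity)]
    calc (2 : ℝ) ^ m ≤ L * P.card := hcard
      _ ≤ L * (C * ((2 * R / b) ^ s' * (q⁻¹ ^ s') ^ m)) := by gcongr
      _ = _ := by ring
  have h5 : ξ ^ m₁ ≤ ξ ^ m := pow_le_pow_right₀ hξ1.le (Nat.le_add_left _ _)
  linarith

theorem assouadDim_eq (h : HasGrowth F q A) (hq : 0 < q) (hq1 : q < 1)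
    (hA : ∀ s m, A (s + m) ≤ A s + m) (hrun : ∀ m, ∃ s, A (s + m) = A s + m)
    {α : ℝ} (hα : 0 ≤ α) (hqα : q⁻¹ ^ α = 2) : assouadDim F = (α : EReal) := by
  refine le_antisymm (sInf_le ⟨α, ⟨hα, h.isHomogeneous hq hq1 hA hα hqα⟩, rfl⟩) (le_sInf ?_)
  rintro _ ⟨s', ⟨-, hs'⟩, rfl⟩
  exact EReal.coe_le_coe_iff.2 (h.le_of_isHomogeneous hq hq1 hrun hqα hs')

end General

theorem prodSetL2 {C D : Set ℝ} {q : ℝ} {A B : ℕ → ℕ} (hC : HasGrowth C q A)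
    (hD : HasGrowth D q B) (hC1 : C ⊆ Set.Icc 0 1) (hD1 : D ⊆ Set.Icc 0 1) (hq : 0 < q) :
    HasGrowth (prodSetL2 C D) q (fun t => A t + B t) := by
  have hmem : ∀ z, z ∈ Paper.prodSetL2 C D ↔ z.fst ∈ C ∧ z.snd ∈ D := by
    intro z
    constructor
    · rintro ⟨w, hw, rfl⟩; exact hw
    · exact fun h => ⟨(z.fst, z.snd), h, rfl⟩
  have hd1 : ∀ z w : WithLp 2 (ℝ × ℝ), dist z.fst w.fst ≤ dist z w := fun z w => by
    rw [WithLp.prod_dist_eq_of_L2]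
    exact Real.le_sqrt_of_sq_le (by nlinarith [sq_nonneg (dist z.snd w.snd)])
  have hd2 : ∀ z w : WithLp 2 (ℝ × ℝ), dist z.snd w.snd ≤ dist z w := fun z w => by
    rw [WithLp.prod_dist_eq_of_L2]
    exact Real.le_sqrt_of_sq_le (by nlinarith [sq_nonneg (dist z.fst w.fst)])
  have hd3 : ∀ z w : WithLp 2 (ℝ × ℝ), dist z w ≤ dist z.fst w.fst + dist z.snd w.snd :=
    fun z w => by
      rw [WithLp.prod_dist_eq_of_L2]
      refine Real.sqrt_le_iff.2 ⟨by positivity, ?_⟩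
      nlinarith [mul_nonneg (dist_nonneg (x := z.fst) (y := w.fst))
        (dist_nonneg (x := z.snd) (y := w.snd))]
  have hdist : ∀ u ∈ Set.Icc (0 : ℝ) 1, ∀ v ∈ Set.Icc (0 : ℝ) 1, dist u v ≤ 1 :=
    fun u hu v hv => by
      rw [Real.dist_eq, abs_le]
      constructor <;> linarith [hu.1, hu.2, hv.1, hv.2]
  obtain ⟨K₁, a₁, ha₁, hK₁⟩ := hC.exists_cover
  obtain ⟨K₂, a₂, ha₂, hK₂⟩ := hD.exists_cover
  obtain ⟨L₁, b₁, hb₁, R₁, hR₁, hL₁⟩ := hC.exists_packing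
  obtain ⟨L₂, b₂, hb₂, R₂, hR₂, hL₂⟩ := hD.exists_packing
  refine ⟨?_, ?_, ⟨K₁ * K₂, a₁ + a₂, by positivity, fun x hx s t hst => ?_⟩,
    ⟨L₁ * L₂, min b₁ b₂, lt_min hb₁ hb₂, R₁ + R₂, by positivity, fun x hx s t hst => ?_⟩⟩
  · obtain ⟨u, hu⟩ := hC.nonempty
    obtain ⟨v, hv⟩ := hD.nonempty
    exact ⟨WithLp.toLp 2 (u, v), (hmem _).2 ⟨hu, hv⟩⟩
  · intro x hx y hy
    rw [hmem] at hx hy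
    have h1 := hdist _ (hC1 hy.1) _ (hC1 hx.1)
    have h2 := hdist _ (hD1 hy.2) _ (hD1 hx.2)
    rw [mem_closedBall]
    linarith [hd3 y x]
  · rw [hmem] at hx
    obtain ⟨Q₁, hQ₁, hc₁⟩ := hK₁ _ hx.1 s t hst
    obtain ⟨Q₂, hQ₂, hc₂⟩ := hK₂ _ hx.2 s t hst
    refine ⟨(Q₁ ×ˢ Q₂).map (WithLp.equiv 2 (ℝ × ℝ)).symm.toEmbedding, ?_, ?_⟩
    · rintro y ⟨hyx, hy⟩
      rw [hmem] at hy
      rw [mem_closedBall] at hyx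
      have h1 := hQ₁ ⟨mem_closedBall.2 ((hd1 y x).trans hyx), hy.1⟩
      have h2 := hQ₂ ⟨mem_closedBall.2 ((hd2 y x).trans hyx), hy.2⟩
      simp only [Set.mem_iUnion, exists_prop, mem_closedBall] at h1 h2 ⊢
      obtain ⟨z₁, hz₁, h1⟩ := h1
      obtain ⟨z₂, hz₂, h2⟩ := h2
      refine ⟨(WithLp.equiv 2 (ℝ × ℝ)).symm (z₁, z₂),
        Finset.mem_map.2 ⟨(z₁, z₂), Finset.mk_mem_product hz₁ hz₂, rfl⟩, ?_⟩
      refine (hd3 _ _).trans ?_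
      rw [add_mul]
      exact add_le_add h1 h2
    · rw [Finset.card_map, Finset.card_product]
      calc _ = (Q₁.card * 2 ^ A s) * (Q₂.card * 2 ^ B s) := by ring
        _ ≤ (K₁ * 2 ^ A t) * (K₂ * 2 ^ B t) := Nat.mul_le_mul hc₁ hc₂
        _ = _ := by ring
  · rw [hmem] at hx
    obtain ⟨P₁, hP₁, hc₁, hs₁⟩ := hL₁ _ hx.1 s t hst
    obtain ⟨P₂, hP₂, hc₂, hs₂⟩ := hL₂ _ hx.2 s t hst
    refine ⟨(P₁ ×ˢ P₂).map (WithLp.equiv 2 (ℝ × ℝ)).symm.toEmbedding, ?_, ?_, ?_⟩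
    · intro y hy
      simp only [Finset.coe_map, Set.mem_image, Finset.mem_coe, Finset.mem_product] at hy
      obtain ⟨w, ⟨hw1, hw2⟩, rfl⟩ := hy
      have h1 := hP₁ hw1
      have h2 := hP₂ hw2
      refine ⟨mem_closedBall.2 ((hd3 _ _).trans ?_), (hmem _).2 ⟨h1.2, h2.2⟩⟩
      rw [add_mul]
      exact add_le_add h1.1 h2.1
    · rw [Finset.card_map, Finset.card_product]
      calc _ = 2 ^ A t * 2 ^ B t := by ring
        _ ≤ (L₁ * P₁.card * 2 ^ A s) * (L₂ * P₂.card * 2 ^ B s) := Nat.mul_le_mul hc₁ hc₂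
        _ = _ := by ring
    · intro y hy z hz hyz
      simp only [Finset.coe_map, Set.mem_image, Finset.mem_coe, Finset.mem_product] at hy hz
      obtain ⟨v, ⟨hv1, hv2⟩, rfl⟩ := hy
      obtain ⟨w, ⟨hw1, hw2⟩, rfl⟩ := hz
      have hqt : 0 < q ^ t := by positivity
      by_cases h : v.1 = w.1
      · have h' : v.2 ≠ w.2 := fun h' => hyz (by rw [Prod.ext h h'])
        calc _ ≤ b₂ * q ^ t := by gcongr; exact min_le_right _ _
          _ < _ := hs₂ hv2 hw2 h'
          _ ≤ _ := hd2 _ _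
      · calc _ ≤ b₁ * q ^ t := by gcongr; exact min_le_left _ _
          _ < _ := hs₁ hv1 hw1 h
          _ ≤ _ := hd1 _ _

end HasGrowth

/-- The initial part, of relative length `β`, of each block `[k ^ 2, (k + 1) ^ 2)`. -/
def blockPred (β : ℝ) (n : ℕ) : Prop :=
  ((n - n.sqrt * n.sqrt : ℕ) : ℝ) < β * (2 * n.sqrt + 1)

section blockPred

variable {β : ℝ}

theorem blockPred_mul_self_add {k j : ℕ} (hj : j ≤ k + k) :
    blockPred β (k * k + j) ↔ (j : ℝ) < β * (2 * k + 1) := by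
  rw [blockPred, Nat.sqrt_add_eq k hj, Nat.add_sub_cancel_left]

theorem exists_run_blockPred (hβ : 0 < β) (hβ1 : β < 1) (m : ℕ) :
    ∃ s ≥ m, ∀ j < m, blockPred β (s + j) := by
  obtain ⟨k, hk⟩ := exists_nat_gt ((m + 1) / β)
  rw [div_lt_iff₀ hβ] at hk
  have hmk : m ≤ k := by
    have : (m : ℝ) ≤ k := by nlinarith [(Nat.cast_nonneg k : (0 : ℝ) ≤ k)]
    exact_mod_cast this
  refine ⟨k * k, hmk.trans (Nat.le_mul_self k), fun j hj => ?_⟩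
  rw [blockPred_mul_self_add (by omega)]
  have : (j : ℝ) < m := by exact_mod_cast hj
  nlinarith [(Nat.cast_nonneg k : (0 : ℝ) ≤ k)]

theorem exists_run_not_blockPred (hβ : 0 < β) (hβ1 : β < 1) (m : ℕ) :
    ∃ s ≥ m, ∀ j < m, ¬ blockPred β (s + j) := by
  have hβ' : 0 < 1 - β := by linarith
  obtain ⟨k, hk⟩ := exists_nat_gt ((m + 1) / (1 - β))
  rw [div_lt_iff₀ hβ'] at hk
  have hk0 : (0 : ℝ) ≤ k := Nat.cast_nonneg k
  have hmk : m ≤ k := by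
    have : (m : ℝ) ≤ k := by nlinarith
    exact_mod_cast this
  set c := ⌈β * (2 * k + 1)⌉₊ with hc
  refine ⟨k * k + c, (hmk.trans (Nat.le_mul_self k)).trans (Nat.le_add_right _ _),
    fun j hj => ?_⟩
  have h1 : (c : ℝ) < β * (2 * k + 1) + 1 := Nat.ceil_lt_add_one (by positivity)
  have h2 : (j : ℝ) + 1 ≤ m := by exact_mod_cast hj
  have h3 : c + j ≤ k + k := by
    have : ((c + j : ℕ) : ℝ) ≤ ((k + k : ℕ) : ℝ) := by
      push_cast
      nlinarith
    exact_mod_cast this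
  rw [add_assoc, blockPred_mul_self_add h3, not_lt]
  push_cast
  have := Nat.le_ceil (β * (2 * k + 1))
  linarith [(Nat.cast_nonneg j : (0 : ℝ) ≤ j)]

theorem infinite_of_exists_run {p : ℕ → Prop} (h : ∀ m, ∃ s ≥ m, ∀ j < m, p (s + j)) :
    (Set.ofPred p).Infinite := by
  refine Set.infinite_of_forall_exists_gt fun a => ?_
  obtain ⟨s, hs, hp⟩ := h (a + 1)
  exact ⟨s, hp 0 (Nat.succ_pos a), hs⟩

theorem count_add_le (p : ℕ → Prop) [DecidablePred p] (s m : ℕ) :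
    Nat.count p (s + m) ≤ Nat.count p s + m := by
  rw [Nat.count_add]
  exact Nat.add_le_add_left (Nat.count_le _) _

theorem exists_count_add_eq {p : ℕ → Prop} [DecidablePred p]
    (h : ∀ m, ∃ s ≥ m, ∀ j < m, p (s + j)) (m : ℕ) :
    ∃ s, Nat.count p (s + m) = Nat.count p s + m := by
  obtain ⟨s, -, hs⟩ := h m
  exact ⟨s, by rw [Nat.count_add, Nat.count_iff_forall.2 hs]⟩

theorem count_add_count_not (p : ℕ → Prop) [DecidablePred p] (n : ℕ) :
    Nat.count p n + Nat.count (fun i => ¬ p i) n = n := by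
  induction n with
  | zero => simp
  | succ n ih =>
    rw [Nat.count_succ, Nat.count_succ]
    split_ifs <;> omega

theorem count_or_zero_le (p : ℕ → Prop) [DecidablePred p] (n : ℕ) :
    Nat.count (fun i => p i ∨ i = 0) n ≤ Nat.count p n + 1 := by
  cases n with
  | zero => simp
  | succ n =>
    induction n with
    | zero => exact (Nat.count_le _).trans (by omega)
    | succ n ih =>
      rw [Nat.count_succ, Nat.count_succ p]
      simp only [Nat.succ_ne_zero, or_false]
      omega

variable [DecidablePred (blockPred β)]

theorem count_blockPred_mul_self_add {k j : ℕ} (hj : j ≤ k + k + 1) :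
    Nat.count (blockPred β) (k * k + j) =
      Nat.count (blockPred β) (k * k) + min ⌈β * (2 * k + 1)⌉₊ j := by
  induction j with
  | zero => simp
  | succ j ih =>
    rw [← add_assoc, Nat.count_succ, ih (by omega)]
    simp only [blockPred_mul_self_add (show j ≤ k + k by omega), ← Nat.lt_ceil]
    split_ifs <;> omega

theorem abs_count_blockPred_mul_self_sub_le (hβ : 0 < β) (hβ1 : β < 1) (k : ℕ) :
    |(Nat.count (blockPred β) (k * k) : ℝ) - β * (k * k)| ≤ k := by
  induction k with
  | zero => simp
  | succ k ih =>
    have h1 := Nat.le_ceil (β * (2 * (k : ℝ) + 1))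
    have h2 : (⌈β * (2 * (k : ℝ) + 1)⌉₊ : ℝ) < β * (2 * k + 1) + 1 :=
      Nat.ceil_lt_add_one (by positivity)
    have h3 : ⌈β * (2 * (k : ℝ) + 1)⌉₊ ≤ k + k + 1 := by
      refine Nat.ceil_le.2 ?_
      push_cast
      nlinarith [(Nat.cast_nonneg k : (0 : ℝ) ≤ k)]
    have h4 := count_blockPred_mul_self_add (β := β) (le_refl (k + k + 1))
    rw [min_eq_left h3, show k * k + (k + k + 1) = (k + 1) * (k + 1) by ring] at h4
    rw [h4]
    push_cast
    rw [abs_le] at ih ⊢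
    constructor <;> nlinarith [ih.1, ih.2]

theorem abs_count_blockPred_sub_le (hβ : 0 < β) (hβ1 : β < 1) (n : ℕ) :
    |(Nat.count (blockPred β) n : ℝ) - β * n| ≤ 3 * √n := by
  obtain ⟨k, j, hj, rfl⟩ : ∃ k j : ℕ, j ≤ 2 * k ∧ n = k * k + j :=
    ⟨n.sqrt, n - n.sqrt * n.sqrt, by have := Nat.sqrt_le_add n; omega,
      (Nat.add_sub_cancel' (Nat.sqrt_le n)).symm⟩
  have h1 := abs_count_blockPred_mul_self_sub_le hβ hβ1 k
  have h2 : (Nat.count (blockPred β) (k * k + j) : ℝ) ≤ Nat.count (blockPred β) (k * k) + j := by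
    exact_mod_cast count_add_le (blockPred β) (k * k) j
  have h3 : (Nat.count (blockPred β) (k * k) : ℝ) ≤ Nat.count (blockPred β) (k * k + j) := by
    exact_mod_cast Nat.count_monotone _ (Nat.le_add_right _ _)
  have h4 : (k : ℝ) ≤ √((k * k + j : ℕ) : ℝ) := by
    refine Real.le_sqrt_of_sq_le ?_
    push_cast
    nlinarith [(Nat.cast_nonneg j : (0 : ℝ) ≤ j)]
  have h5 : (j : ℝ) ≤ 2 * k := by exact_mod_cast hj
  have h6 : β * j ≤ j := mul_le_of_le_one_left (Nat.cast_nonneg j) hβ1.le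
  have h7 : 0 ≤ β * j := by positivity
  refine le_trans ?_ (mul_le_mul_of_nonneg_left h4 (by norm_num))
  rw [abs_le] at h1 ⊢
  push_cast
  constructor <;> linarith [h1.1, h1.2]

theorem tendsto_count_blockPred_div (hβ : 0 < β) (hβ1 : β < 1) :
    Tendsto (fun n : ℕ => (Nat.count (blockPred β) n : ℝ) / n) atTop (nhds β) := by
  have h0 : Tendsto (fun n : ℕ => 3 / √(n : ℝ)) atTop (nhds 0) :=
    (Real.tendsto_sqrt_atTop.comp tendsto_natCast_atTop_atTop).const_div_atTop 3
  rw [tendsto_iff_dist_tendsto_zero]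
  refine squeeze_zero' (.of_forall fun _ => dist_nonneg) ?_ h0
  filter_upwards [eventually_gt_atTop 0] with n hn
  have hn' : (0 : ℝ) < n := by exact_mod_cast hn
  have hs : 0 < √(n : ℝ) := Real.sqrt_pos.2 hn'
  have h1 := abs_count_blockPred_sub_le hβ hβ1 n
  rw [Real.dist_eq, show (Nat.count (blockPred β) n : ℝ) / n - β =
    (Nat.count (blockPred β) n - β * n) / n by field_simp, abs_div, abs_of_pos hn',
    div_le_div_iff₀ hn' hs]
  calc _ ≤ 3 * √(n : ℝ) * √(n : ℝ) := mul_le_mul_of_nonneg_right h1 hs.le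
    _ = 3 * n := by rw [mul_assoc, Real.mul_self_sqrt hn'.le]

theorem tendsto_count_not_blockPred_div (hβ : 0 < β) (hβ1 : β < 1) :
    Tendsto (fun n : ℕ => (Nat.count (fun i => ¬ blockPred β i) n : ℝ) / n) atTop
      (nhds (1 - β)) := by
  refine ((tendsto_count_blockPred_div hβ hβ1).const_sub 1).congr' ?_
  filter_upwards [eventually_gt_atTop 0] with n hn
  have hn' : (n : ℝ) ≠ 0 := by exact_mod_cast hn.ne'
  have h : (Nat.count (blockPred β) n : ℝ) + Nat.count (fun i => ¬ blockPred β i) n = n := by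
    exact_mod_cast count_add_count_not (blockPred β) n
  rw [one_sub_div hn', ← h]
  ring

end blockPred

theorem statement17 (α β : ℝ) (hα : α ∈ Set.Ioo (0 : ℝ) 1) (hβ : β ∈ Set.Ioo (0 : ℝ) 1) :
    ∃ lam mu : ℕ → ℝ,
      (∀ i, lam i ∈ Set.Ioo (0 : ℝ) (1 / 2)) ∧ (∀ i, mu i ∈ Set.Ioo (0 : ℝ) (1 / 2)) ∧
      cantorSet lam ⊆ Set.Icc 0 1 ∧ cantorSet mu ⊆ Set.Icc 0 1 ∧
      lowerBoxDim (cantorSet lam) = α * β ∧ upperBoxDim (cantorSet lam) = α * β ∧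
      lowerBoxDim (cantorSet mu) = α * (1 - β) ∧ upperBoxDim (cantorSet mu) = α * (1 - β) ∧
      lowerBoxDim (prodSetL2 (cantorSet lam) (cantorSet mu)) = α ∧
      upperBoxDim (prodSetL2 (cantorSet lam) (cantorSet mu)) = α ∧
      assouadDim (prodSetL2 (cantorSet lam) (cantorSet mu)) = (α : EReal) ∧
      assouadDim (cantorSet lam) = (α : EReal) ∧
      assouadDim (cantorSet mu) = (α : EReal) := by
  classical
  obtain ⟨hα0, hα1⟩ := hα
  obtain ⟨hβ0, hβ1⟩ := hβ
  have hl2 : 0 < Real.log 2 := Real.log_pos one_lt_two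
  set q : ℝ := 2 ^ (-(1 / α)) with hqdef
  have hq : 0 < q := by positivity
  have hq2 : q < 1 / 2 := by
    have h1 : 1 < 1 / α := (one_lt_div hα0).2 hα1
    calc q < 2 ^ (-1 : ℝ) := Real.rpow_lt_rpow_of_exponent_lt one_lt_two (by linarith)
      _ = 1 / 2 := by rw [Real.rpow_neg_one, one_div]
  have hq1 : q < 1 := by linarith
  have hqα : q⁻¹ ^ α = 2 := by
    rw [hqdef, ← Real.rpow_neg two_pos.le, neg_neg, ← Real.rpow_mul two_pos.le,
      one_div_mul_cancel hα0.ne', Real.rpow_one]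
  have hdim : ∀ θ : ℝ, θ * Real.log 2 / (-Real.log q) = α * θ := fun θ => by
    rw [hqdef, Real.log_rpow two_pos]
    field_simp
  set p : ℕ → Prop := blockPred β with hp
  have hrun := exists_run_blockPred hβ0 hβ1
  have hrun' := exists_run_not_blockPred hβ0 hβ1
  have hinf : (Set.ofPred p).Infinite := infinite_of_exists_run hrun
  have hinf' : (Set.ofPred fun i => ¬ p i ∨ i = 0).Infinite :=
    (infinite_of_exists_run hrun').mono fun i hi => Or.inl hi
  have hp0 : p 0 := by
    have := blockPred_mul_self_add (β := β) (le_refl (0 + 0))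
    simpa [hβ0] using this
  have hC := hasGrowth_cantorSet hq hq2 hinf hp0
  have hD : HasGrowth (cantorSet (cantorRatio q fun i => ¬ p i ∨ i = 0)) q
      (Nat.count fun i => ¬ p i) :=
    (hasGrowth_cantorSet hq hq2 hinf' (Or.inr rfl)).congr (c := 1) (count_or_zero_le _)
      fun t => (Nat.count_mono_left fun _ _ => Or.inl).trans (Nat.le_succ _)
  have hCD := hC.prodSetL2 hD (cantorSet_subset_Icc _) (cantorSet_subset_Icc _) hq
  simp only [count_add_count_not] at hCD
  have hCbox := hC.boxDim_eq hq hq1 (count_add_le _) (tendsto_count_blockPred_div hβ0 hβ1)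
  have hDbox := hD.boxDim_eq hq hq1 (count_add_le _) (tendsto_count_not_blockPred_div hβ0 hβ1)
  have hCDbox := hCD.boxDim_eq hq hq1 (fun _ _ => le_rfl) (θ := 1)
    (tendsto_const_nhds.congr' (by
      filter_upwards [eventually_gt_atTop 0] with n hn
      rw [div_self (by exact_mod_cast hn.ne')]))
  rw [hdim] at hCbox hDbox hCDbox
  rw [mul_one] at hCDbox
  exact ⟨_, _, cantorRatio_mem_Ioo hq hq2 hinf, cantorRatio_mem_Ioo hq hq2 hinf',
    cantorSet_subset_Icc _, cantorSet_subset_Icc _, hCbox.1, hCbox.2, hDbox.1, hDbox.2,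
    hCDbox.1, hCDbox.2,
    hCD.assouadDim_eq hq hq1 (fun _ _ => le_rfl) (fun _ => ⟨0, rfl⟩) hα0.le hqα,
    hC.assouadDim_eq hq hq1 (count_add_le _) (exists_count_add_eq hrun) hα0.le hqα,
    hD.assouadDim_eq hq hq1 (count_add_le _) (exists_count_add_eq hrun') hα0.le hqα⟩

end Paper
end
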